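/- arXiv:math/0303098 — 2 statements merged into one kernel-verified Lean document; each statement's English description precedes it below -/
import Mathlib

section
/- Let B be a basis of V which is equivalent to a basis whose graph is a tree of type D_{m,k} with m≥2, k≥1. Then: (i) if m>2 then dim V₀₀₀ = k−1, and if m=2 then dim V₀ = dim V₀₀₀ = k; (ii) the number of vectors of V fixed by every element of Γ_B is 2^{k−1} if m is odd and 2^k if m is even; (iii) the number of Γ_B-orbits in V containing more than one element is (m+1)/2 if m is odd and m/2 if m is even. -/
open scoped BigOperators

/-- A `ZMod 2`-valued bilinear form on `V`. -/
abbrev BForm (V : Type*) [AddCommGroup V] [Module (ZMod 2) V] :=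
  V →ₗ[ZMod 2] V →ₗ[ZMod 2] ZMod 2

variable {V : Type*} [AddCommGroup V] [Module (ZMod 2) V]

/-- `g` is the transvection `τ_b : x ↦ x + Ω(x,b)·b` for some `b ∈ B`. -/
def IsTransvection (Ω : BForm V) (B : Set V) (g : V ≃ₗ[ZMod 2] V) : Prop :=
  ∃ b ∈ B, ∀ x : V, g x = x + Ω x b • b

/-- The group `Γ_B` generated by the transvections `τ_b`, `b ∈ B`. -/
def Gamma (Ω : BForm V) (B : Set V) : Subgroup (V ≃ₗ[ZMod 2] V) :=
  Subgroup.closure {g | IsTransvection Ω B g}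

/-- `x` and `y` lie in the same `Γ_B`-orbit. -/
def SameOrbit (Ω : BForm V) (B : Set V) (x y : V) : Prop :=
  ∃ g ∈ Gamma Ω B, g x = y

/-- The graph `Gr(X)` on vertex set `X`, with `b, b'` adjacent iff `Ω(b,b') = 1` or `Ω(b',b) = 1`. -/
def Gr (Ω : BForm V) (X : Set V) : SimpleGraph X :=
  SimpleGraph.fromRel fun a b => Ω a.1 b.1 = 1

/-- One basic move: `B' = φ_{c,a}(B)`, replacing `c` by `c + a`. -/
def MoveRel (Ω : BForm V) (B B' : Set V) : Prop :=
  ∃ a c, a ∈ B ∧ c ∈ B ∧ a ≠ c ∧ Ω a c = 1 ∧ B' = insert (c + a) (B \ {c})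

/-- `B` and `B'` are equivalent: related by a finite sequence of basic moves. -/
def EquivSets (Ω : BForm V) : Set V → Set V → Prop :=
  Relation.ReflTransGen (MoveRel Ω)

/-- The kernel `V₀` of the form `Ω`. -/
def V0set (Ω : BForm V) : Set V := {x | ∀ v : V, Ω x v = 0}

/-- `Δ`, the `Γ_B`-orbit containing `B` (when `Gr(B)` is connected). -/
def Delta (Ω : BForm V) (B : Set V) : Set V :=
  {x | ∃ b ∈ B, SameOrbit Ω B b x}

/-- `V₀₀₀`: vectors of `V₀` of the form `x₁ + x₂` with `x₁, x₂ ∈ Δ`. -/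
def V000set (Ω : BForm V) (B : Set V) : Set V :=
  {y | y ∈ V0set Ω ∧ ∃ x₁ ∈ Delta Ω B, ∃ x₂ ∈ Delta Ω B, y = x₁ + x₂}

/-- `U₀₀₀` for `U = span(B)`: vectors of `U₀` of the form `x₁ + x₂` with `x₁, x₂ ∈ Δ`. -/
def U000set (Ω : BForm V) (B : Set V) : Set V :=
  {y | y ∈ Submodule.span (ZMod 2) B ∧ (∀ u ∈ Submodule.span (ZMod 2) B, Ω y u = 0) ∧
    ∃ x₁ ∈ Delta Ω B, ∃ x₂ ∈ Delta Ω B, y = x₁ + x₂}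

/-- `x = x₁ + ⋯ + x_s` with all `x_i ∈ Δ` and `Ω(x_i, x_j) = 0`: a `Δ`-decomposition. -/
def HasDeltaDecomp (Ω : BForm V) (B : Set V) (x : V) (s : ℕ) : Prop :=
  1 ≤ s ∧ ∃ f : Fin s → V, (∀ i, f i ∈ Delta Ω B) ∧
    (∀ i j, i ≠ j → Ω (f i) (f j) = 0) ∧ x = ∑ i, f i

/-- `d(x)`: minimal length of a `Δ`-decomposition of `x`. -/
noncomputable def dval (Ω : BForm V) (B : Set V) (x : V) : ℕ :=
  sInf {s | HasDeltaDecomp Ω B x s}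

/-- `Q` is the quadratic form associated with `Ω` and `S` (`Q(b)=1` on `S`, polarization `Ω`). -/
def IsQuadForm (Ω : BForm V) (S : Set V) (Q : V → ZMod 2) : Prop :=
  (∀ b ∈ S, Q b = 1) ∧ ∀ u v : V, Q (u + v) = Q u + Q v + Ω u v

/-- The tree of type `D_{m,k}`: path `a₁ — ⋯ — a_m` with leaves `c₁, …, c_k` attached to `a_m`. -/
def DmkGraph (m k : ℕ) : SimpleGraph (Fin m ⊕ Fin k) :=
  SimpleGraph.fromRel fun x y =>
    match x, y with
    | Sum.inl i, Sum.inl j => i.val + 1 = j.val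
    | Sum.inl i, Sum.inr _ => i.val + 1 = m
    | _, _ => False

/-- The Dynkin tree `E₆`. -/
def E6Graph : SimpleGraph (Fin 6) :=
  SimpleGraph.fromRel fun i j => (i.val, j.val) ∈ [(0,1),(1,2),(2,3),(3,4),(2,5)]

/-- Two triangles sharing a common edge: four vertices, five edges. -/
def TwoTrianglesGraph : SimpleGraph (Fin 4) :=
  SimpleGraph.fromRel fun i j => (i.val, j.val) ∈ [(0,1),(0,2),(0,3),(1,2),(1,3)]

/-- The cycle of length `n`. -/
def CycleGraph (n : ℕ) : SimpleGraph (Fin n) :=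
  SimpleGraph.fromRel fun i j => j.val = (i.val + 1) % n

/-- Membership in the family `F`: type `D_{2,2}`, two triangles sharing an edge,
or a cycle of length at least `4`. -/
def InF {α : Type*} (G : SimpleGraph α) : Prop :=
  Nonempty (G ≃g DmkGraph 2 2) ∨ Nonempty (G ≃g TwoTrianglesGraph) ∨
    ∃ n, 4 ≤ n ∧ Nonempty (G ≃g CycleGraph n)

/-- `B` is equivalent to a set whose graph is a tree of type `D_{m,k}`. -/
def EquivToDmkTree (Ω : BForm V) (B : Set V) (m k : ℕ) : Prop :=
  ∃ B' : Set V, EquivSets Ω B B' ∧ Nonempty (Gr Ω B' ≃g DmkGraph m k)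

/-- `X` is equivalent to a set whose graph is `E₆`. -/
def EquivToE6 (Ω : BForm V) (X : Set V) : Prop :=
  ∃ X' : Set V, EquivSets Ω X X' ∧ Nonempty (Gr Ω X' ≃g E6Graph)

/-- Some subset of `B` is equivalent to a set whose graph is `E₆`. -/
def HasE6Subgraph (Ω : BForm V) (B : Set V) : Prop :=
  ∃ X ⊆ B, EquivToE6 Ω X

/-- `B` is a basis of `V` (as a set). -/
def IsBasisSet (B : Set V) : Prop :=
  LinearIndependent (ZMod 2) (Subtype.val : B → V) ∧ Submodule.span (ZMod 2) B = ⊤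

/-- `B` is equivalent to a set whose graph is a tree containing `E₆` as an induced subgraph. -/
def EquivToE6Tree (Ω : BForm V) (B : Set V) : Prop :=
  ∃ B' : Set V, EquivSets Ω B B' ∧ (Gr Ω B').IsTree ∧
    ∃ X ⊆ B', Nonempty (Gr Ω X ≃g E6Graph)

/-- `A` is a maximal complete subgraph (maximal clique) of `G`. -/
def IsMaxClique {α : Type*} (G : SimpleGraph α) (A : Set α) : Prop :=
  G.IsClique A ∧ ∀ A', G.IsClique A' → A ⊆ A' → A' = A

/-! ### Transvections and invariance under basic moves -/

section Transvections

variable {Ω : BForm V}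

lemma apply_swap_of_alternating (hΩ : ∀ x : V, Ω x x = 0) (x y : V) : Ω x y = Ω y x := by
  have h := hΩ (x + y)
  simp only [map_add, LinearMap.add_apply, hΩ, zero_add, add_zero] at h
  exact (CharTwo.add_eq_zero.1 h).symm

/-- The transvection `x ↦ x + Ω(x,b)·b` as a linear automorphism. -/
def transvectionEquiv (hΩ : ∀ x : V, Ω x x = 0) (b : V) : V ≃ₗ[ZMod 2] V :=
  LinearEquiv.ofInvolutive (LinearMap.id + (Ω.flip b).smulRight b) fun x => by
    simp [hΩ, add_assoc, ZModModule.add_self]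

@[simp]
lemma transvectionEquiv_apply (hΩ : ∀ x : V, Ω x x = 0) (b x : V) :
    transvectionEquiv hΩ b x = x + Ω x b • b := rfl

lemma isTransvection_iff (hΩ : ∀ x : V, Ω x x = 0) {B : Set V} {g : V ≃ₗ[ZMod 2] V} :
    IsTransvection Ω B g ↔ ∃ b ∈ B, g = transvectionEquiv hΩ b := by
  simp only [IsTransvection, LinearEquiv.ext_iff, transvectionEquiv_apply]

lemma transvectionEquiv_mem (hΩ : ∀ x : V, Ω x x = 0) {B : Set V} {b : V} (hb : b ∈ B) :
    transvectionEquiv hΩ b ∈ Gamma Ω B :=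
  Subgroup.subset_closure ((isTransvection_iff hΩ).2 ⟨b, hb, rfl⟩)

lemma gamma_le_iff (hΩ : ∀ x : V, Ω x x = 0) {B : Set V} {G : Subgroup (V ≃ₗ[ZMod 2] V)} :
    Gamma Ω B ≤ G ↔ ∀ b ∈ B, transvectionEquiv hΩ b ∈ G := by
  refine ⟨fun h b hb => h (transvectionEquiv_mem hΩ hb), fun h => ?_⟩
  rw [Gamma, Subgroup.closure_le]
  intro g hg
  obtain ⟨b, hb, rfl⟩ := (isTransvection_iff hΩ).1 hg
  exact h b hb

lemma transvectionEquiv_add_mem (hΩ : ∀ x : V, Ω x x = 0) {G : Subgroup (V ≃ₗ[ZMod 2] V)}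
    {a c : V} (hac : Ω a c = 1) (ha : transvectionEquiv hΩ a ∈ G)
    (hc : transvectionEquiv hΩ c ∈ G) : transvectionEquiv hΩ (c + a) ∈ G := by
  have hca : Ω c a = 1 := by rw [apply_swap_of_alternating hΩ, hac]
  have h : transvectionEquiv hΩ (c + a) =
      transvectionEquiv hΩ a * transvectionEquiv hΩ c * transvectionEquiv hΩ a := by
    ext x
    simp only [transvectionEquiv_apply, LinearEquiv.mul_apply, map_add, map_smul,
      hac, hca, hΩ]
    generalize Ω x a = s
    generalize Ω x c = t
    match_scalars <;> revert s t <;> decide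
  rw [h]
  exact G.mul_mem (G.mul_mem ha hc) ha

lemma SameOrbit.refl (B : Set V) (x : V) : SameOrbit Ω B x x := ⟨1, one_mem _, rfl⟩

lemma SameOrbit.symm {B : Set V} {x y : V} : SameOrbit Ω B x y → SameOrbit Ω B y x := by
  rintro ⟨g, hg, rfl⟩
  exact ⟨g⁻¹, inv_mem hg, g.symm_apply_apply x⟩

lemma SameOrbit.trans {B : Set V} {x y z : V} :
    SameOrbit Ω B x y → SameOrbit Ω B y z → SameOrbit Ω B x z := by
  rintro ⟨g, hg, rfl⟩ ⟨h, hh, rfl⟩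
  exact ⟨h * g, mul_mem hh hg, rfl⟩

lemma sameOrbit_transvection (hΩ : ∀ x : V, Ω x x = 0) {B : Set V} {b : V} (hb : b ∈ B) (x : V) :
    SameOrbit Ω B x (x + Ω x b • b) :=
  ⟨_, transvectionEquiv_mem hΩ hb, rfl⟩

lemma delta_subset_of_subset {B B' : Set V} (hG : Gamma Ω B = Gamma Ω B')
    (h : B ⊆ Delta Ω B') : Delta Ω B ⊆ Delta Ω B' := by
  rintro x ⟨b, hb, hx⟩
  obtain ⟨b', hb', hb⟩ := h hb
  have hx' : SameOrbit Ω B' b x := by rwa [SameOrbit, ← hG]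
  exact ⟨b', hb', hb.trans hx'⟩

lemma MoveRel.invariants (hΩ : ∀ x : V, Ω x x = 0) {B B' : Set V} (h : MoveRel Ω B B') :
    Gamma Ω B = Gamma Ω B' ∧ Delta Ω B = Delta Ω B' ∧
      Submodule.span (ZMod 2) B = Submodule.span (ZMod 2) B' := by
  obtain ⟨a, c, ha, hc, hne, hac, rfl⟩ := h
  set B' := insert (c + a) (B \ {c}) with hB'
  have ha' : a ∈ B' := Or.inr ⟨ha, hne⟩
  have hca' : c + a ∈ B' := Or.inl rfl
  have hcaa : c + a + a = c := by rw [add_assoc, ZModModule.add_self, add_zero]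
  have haca : Ω a (c + a) = 1 := by simp [hac, hΩ]
  have hsub : ∀ b ∈ B, b = c ∨ b ∈ B' := fun b hb => by
    by_cases hbc : b = c
    · exact Or.inl hbc
    · exact Or.inr (Or.inr ⟨hb, hbc⟩)
  have hsub' : ∀ b ∈ B', b = c + a ∨ b ∈ B := fun b hb => hb.imp id fun h => h.1
  have hG : Gamma Ω B = Gamma Ω B' := by
    refine le_antisymm ((gamma_le_iff hΩ).2 fun b hb => ?_) ((gamma_le_iff hΩ).2 fun b hb => ?_)
    · rcases hsub b hb with rfl | hb
      · have := transvectionEquiv_add_mem hΩ haca (transvectionEquiv_mem hΩ ha')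
          (transvectionEquiv_mem hΩ hca')
        rwa [hcaa] at this
      · exact transvectionEquiv_mem hΩ hb
    · rcases hsub' b hb with rfl | hb
      · exact transvectionEquiv_add_mem hΩ hac (transvectionEquiv_mem hΩ ha)
          (transvectionEquiv_mem hΩ hc)
      · exact transvectionEquiv_mem hΩ hb
  refine ⟨hG, Set.Subset.antisymm (delta_subset_of_subset hG fun b hb => ?_)
    (delta_subset_of_subset hG.symm fun b hb => ?_),
    le_antisymm (Submodule.span_le.2 fun b hb => ?_) (Submodule.span_le.2 fun b hb => ?_)⟩
  · rcases hsub b hb with rfl | hb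
    · have := sameOrbit_transvection hΩ ha' (b + a)
      rw [apply_swap_of_alternating hΩ, haca, one_smul, hcaa] at this
      exact ⟨_, hca', this⟩
    · exact ⟨b, hb, .refl _ _⟩
  · rcases hsub' b hb with rfl | hb
    · have := sameOrbit_transvection hΩ ha c
      rw [apply_swap_of_alternating hΩ, hac, one_smul] at this
      exact ⟨_, hc, this⟩
    · exact ⟨b, hb, .refl _ _⟩
  · rcases hsub b hb with rfl | hb
    · rw [← hcaa]
      exact add_mem (Submodule.subset_span hca') (Submodule.subset_span ha')
    · exact Submodule.subset_span hb
  · rcases hsub' b hb with rfl | hb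
    · exact add_mem (Submodule.subset_span hc) (Submodule.subset_span ha)
    · exact Submodule.subset_span hb

lemma MoveRel.ncard_le [Finite V] {B B' : Set V} (h : MoveRel Ω B B') : B'.ncard ≤ B.ncard := by
  obtain ⟨a, c, -, hc, -, -, rfl⟩ := h
  refine (Set.ncard_insert_le _ _).trans ?_
  rw [Set.ncard_sdiff_singleton_add_one hc]

lemma EquivSets.invariants [Finite V] (hΩ : ∀ x : V, Ω x x = 0) {B B' : Set V}
    (h : EquivSets Ω B B') :
    Gamma Ω B = Gamma Ω B' ∧ Delta Ω B = Delta Ω B' ∧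
      Submodule.span (ZMod 2) B = Submodule.span (ZMod 2) B' ∧ B'.ncard ≤ B.ncard := by
  induction h with
  | refl => exact ⟨rfl, rfl, rfl, le_rfl⟩
  | tail _ hmove ih =>
    obtain ⟨h1, h2, h3⟩ := hmove.invariants hΩ
    exact ⟨ih.1.trans h1, ih.2.1.trans h2, ih.2.2.1.trans h3, hmove.ncard_le.trans ih.2.2.2⟩

end Transvections

/-! ### Binary vectors -/

section BinaryVectors

variable {m : ℕ}

/-- The indicator vector of the pair `{i, i + 1}`. -/
def edgeVec (i : Fin (m + 1)) : Fin (m + 2) → ZMod 2 :=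
  Pi.single i.castSucc 1 + Pi.single i.succ 1

lemma dotProduct_edgeVec (v : Fin (m + 2) → ZMod 2) (i : Fin (m + 1)) :
    v ⬝ᵥ edgeVec i = v i.castSucc + v i.succ := by
  simp [edgeVec, dotProduct_add]

lemma add_smul_edgeVec (v : Fin (m + 2) → ZMod 2) (i : Fin (m + 1)) :
    v + (v ⬝ᵥ edgeVec i) • edgeVec i = v ∘ Equiv.swap i.castSucc i.succ := by
  have hne : i.castSucc ≠ i.succ := Fin.castSucc_lt_succ.ne
  have ht : ∀ a b : ZMod 2, a + (a + b) = b := by decide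
  have ht' : ∀ a b : ZMod 2, b + (a + b) = a := by decide
  ext j
  rw [dotProduct_edgeVec]
  by_cases h1 : j = i.castSucc
  · subst h1
    simp [edgeVec, hne, ht]
  · by_cases h2 : j = i.succ
    · subst h2
      simp [edgeVec, hne.symm, ht']
    · simp [edgeVec, h1, h2, Equiv.swap_apply_of_ne_of_ne]

lemma sum_edgeVec (i : Fin (m + 1)) : ∑ j, edgeVec i j = 0 := by
  simp [edgeVec, Finset.sum_add_distrib]
  rfl

lemma hammingNorm_edgeVec (i : Fin (m + 1)) : hammingNorm (edgeVec i) = 2 := by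
  have hne : i.castSucc ≠ i.succ := Fin.castSucc_lt_succ.ne
  have : ({j | edgeVec i j ≠ 0} : Finset (Fin (m + 2))) = {i.castSucc, i.succ} := by
    ext j
    rw [Finset.mem_filter_univ]
    by_cases h1 : j = i.castSucc
    · subst h1
      simp [edgeVec, hne]
    · by_cases h2 : j = i.succ
      · subst h2
        simp [edgeVec, hne.symm]
      · simp [edgeVec, h1, h2]
  rw [hammingNorm, this, Finset.card_pair hne]

lemma zmod_two_eq_one_of_ne_zero {a : ZMod 2} (h : a ≠ 0) : a = 1 := by
  revert a; decide

variable {n : ℕ}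

lemma sum_eq_hammingNorm (v : Fin n → ZMod 2) : ∑ j, v j = (hammingNorm v : ZMod 2) := by
  rw [hammingNorm, Finset.card_filter, Nat.cast_sum]
  refine Finset.sum_congr rfl fun j _ => ?_
  split_ifs with h
  · simpa using zmod_two_eq_one_of_ne_zero h
  · simpa using h

lemma hammingNorm_comp_perm (v : Fin n → ZMod 2) (σ : Equiv.Perm (Fin n)) :
    hammingNorm (v ∘ σ) = hammingNorm v := by
  rw [hammingNorm, hammingNorm, Finset.card_filter, Finset.card_filter]
  exact Equiv.sum_comp σ fun j => if v j ≠ 0 then 1 else 0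

lemma exists_perm_of_hammingNorm_eq {v w : Fin n → ZMod 2} (h : hammingNorm v = hammingNorm w) :
    ∃ σ : Equiv.Perm (Fin n), v ∘ σ = w := by
  have e : {j // w j ≠ 0} ≃ {j // v j ≠ 0} := by
    refine Fintype.equivOfCardEq ?_
    rw [Fintype.card_subtype, Fintype.card_subtype]
    exact h.symm
  refine ⟨e.extendSubtype, funext fun j => ?_⟩
  by_cases hj : w j ≠ 0
  · have := e.extendSubtype_mem j hj
    rw [Function.comp_apply, zmod_two_eq_one_of_ne_zero this, zmod_two_eq_one_of_ne_zero hj]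
  · have := e.extendSubtype_not_mem j hj
    rw [not_not] at hj this
    rw [Function.comp_apply, this, hj]

lemma hammingNorm_add_le (v w : Fin n → ZMod 2) :
    hammingNorm (v + w) ≤ hammingNorm v + hammingNorm w := by
  have := hammingDist_triangle (-v) 0 w
  rwa [hammingDist_eq_hammingNorm, neg_neg, hammingDist_zero_right, hammingDist_zero_left,
    ZModModule.neg_eq_self] at this

lemma exists_hammingNorm_eq {w : ℕ} (hw : w ≤ n) :
    ∃ v : Fin n → ZMod 2, hammingNorm v = w := by
  obtain ⟨s, -, hs⟩ := Finset.exists_subset_card_eq (s := (Finset.univ : Finset (Fin n)))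
    (n := w) (by simpa using hw)
  refine ⟨fun j => if j ∈ s then 1 else 0, ?_⟩
  simp [hammingNorm, hs]

lemma constant_iff_hammingNorm (v : Fin n → ZMod 2) :
    (∀ i j, v i = v j) ↔ hammingNorm v = 0 ∨ hammingNorm v = n := by
  constructor
  · intro h
    by_cases h0 : v = 0
    · simp [h0]
    · obtain ⟨i, hi⟩ := Function.ne_iff.1 h0
      right
      have : ∀ j, v j ≠ 0 := fun j => by rw [h j i]; exact hi
      simp [hammingNorm, this]
  · rintro (h | h) i j
    · simp [hammingNorm_eq_zero.1 h]
    · have : ∀ j, v j ≠ 0 := by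
        have h' : (Finset.univ.filter fun j => v j ≠ 0) = Finset.univ :=
          Finset.eq_univ_of_card _ (by simpa [hammingNorm] using h)
        intro j
        have := Finset.mem_univ j
        rw [← h'] at this
        simpa using this
      rw [zmod_two_eq_one_of_ne_zero (this i), zmod_two_eq_one_of_ne_zero (this j)]

end BinaryVectors

/-! ### Coordinates on a tree of type `D_{m,k}` -/

lemma sum_apply_eq_zero_of_span_eq_top {B : Set V} {m : ℕ}
    {φ : V →ₗ[ZMod 2] (Fin (m + 2) → ZMod 2)} (hspan : Submodule.span (ZMod 2) B = ⊤)
    (hB : ∀ b ∈ B, ∃ i, φ b = edgeVec i) (x : V) : ∑ j, φ x j = 0 := by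
  have hx : x ∈ Submodule.span (ZMod 2) B := by rw [hspan]; trivial
  induction hx using Submodule.span_induction with
  | mem b hb =>
    obtain ⟨i, hi⟩ := hB b hb
    rw [hi, sum_edgeVec]
  | zero => simp
  | add x y _ _ hx hy => simp [Finset.sum_add_distrib, hx, hy]
  | smul t x _ hx => simp [← Finset.mul_sum, hx]

/-- `φ` maps `V` onto the even-weight binary vectors of length `m + 2`, turns `Ω` into the dot
product and `B` into pairs of neighbouring positions, and has a kernel of dimension `k - 1`
generated by sums of two elements of `B`. -/
structure IsEvenCoordinates (Ω : BForm V) (B : Set V) (m k : ℕ)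
    (φ : V →ₗ[ZMod 2] (Fin (m + 2) → ZMod 2)) : Prop where
  form (x y : V) : Ω x y = φ x ⬝ᵥ φ y
  span_eq_top : Submodule.span (ZMod 2) B = ⊤
  exists_edgeVec (b : V) (hb : b ∈ B) : ∃ i, φ b = edgeVec i
  exists_mem (i : Fin (m + 1)) : ∃ b ∈ B, φ b = edgeVec i
  exists_preimage (v : Fin (m + 2) → ZMod 2) (hv : ∑ j, v j = 0) : ∃ x, φ x = v
  ker_le : LinearMap.ker φ ≤
    Submodule.span (ZMod 2) {z | ∃ b ∈ B, ∃ b' ∈ B, φ b = φ b' ∧ z = b + b'}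
  finrank_ker : Module.finrank (ZMod 2) (LinearMap.ker φ) = k - 1

namespace IsEvenCoordinates

variable {Ω : BForm V} {B : Set V} {m k : ℕ} {φ : V →ₗ[ZMod 2] (Fin (m + 2) → ZMod 2)}

lemma sum_map (h : IsEvenCoordinates Ω B m k φ) (x : V) : ∑ j, φ x j = 0 :=
  sum_apply_eq_zero_of_span_eq_top h.span_eq_top h.exists_edgeVec x

lemma even_hammingNorm (h : IsEvenCoordinates Ω B m k φ) (x : V) : Even (hammingNorm (φ x)) := by
  have := h.sum_map x
  rwa [sum_eq_hammingNorm, ZMod.natCast_eq_zero_iff_even] at this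

lemma mem_ker_iff (h : IsEvenCoordinates Ω B m k φ) (x : V) :
    x ∈ LinearMap.ker Ω ↔ ∀ b ∈ B, Ω x b = 0 := by
  refine ⟨fun hx b _ => by rw [LinearMap.mem_ker.1 hx]; rfl, fun hx => ?_⟩
  exact LinearMap.ext_on h.span_eq_top fun b hb => by rw [hx b hb]; rfl

lemma mem_ker_iff_constant (h : IsEvenCoordinates Ω B m k φ) (x : V) :
    x ∈ LinearMap.ker Ω ↔ ∀ i j, φ x i = φ x j := by
  constructor
  · intro hx
    have hstep : ∀ i : Fin (m + 1), φ x i.succ = φ x i.castSucc := fun i => by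
      obtain ⟨b, hb, hbi⟩ := h.exists_mem i
      have := (h.mem_ker_iff x).1 hx b hb
      rw [h.form, hbi, dotProduct_edgeVec] at this
      exact (CharTwo.add_eq_zero.1 this).symm
    have hzero : ∀ i, φ x i = φ x 0 := fun i => by
      induction i using Fin.induction with
      | zero => rfl
      | succ i ih => rw [hstep, ih]
    intro i j
    rw [hzero i, hzero j]
  · intro hx
    ext y
    have : φ x = fun _ => φ x 0 := funext fun i => hx i 0
    rw [h.form, this, dotProduct, ← Finset.mul_sum, h.sum_map, mul_zero]
    rfl

lemma mem_ker_iff_hammingNorm (h : IsEvenCoordinates Ω B m k φ) (x : V) :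
    x ∈ LinearMap.ker Ω ↔ hammingNorm (φ x) = 0 ∨ hammingNorm (φ x) = m + 2 := by
  rw [h.mem_ker_iff_constant, constant_iff_hammingNorm]

lemma ker_le_ker (h : IsEvenCoordinates Ω B m k φ) : LinearMap.ker φ ≤ LinearMap.ker Ω := by
  intro x hx
  rw [h.mem_ker_iff_hammingNorm, LinearMap.mem_ker.1 hx]
  simp

lemma map_transvection (h : IsEvenCoordinates Ω B m k φ) (x : V) {b : V} {i : Fin (m + 1)}
    (hb : φ b = edgeVec i) :
    φ (x + Ω x b • b) = φ x ∘ Equiv.swap i.castSucc i.succ := by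
  rw [map_add, map_smul, h.form, hb, add_smul_edgeVec]

lemma exists_mem_gamma (h : IsEvenCoordinates Ω B m k φ) (hΩ : ∀ x : V, Ω x x = 0)
    (σ : Equiv.Perm (Fin (m + 2))) : ∃ g ∈ Gamma Ω B, ∀ x, φ (g x) = φ x ∘ σ := by
  have hσ : σ ∈ Submonoid.closure (Set.range fun i : Fin (m + 1) =>
      Equiv.swap i.castSucc i.succ) := by
    rw [Equiv.Perm.mclosure_swap_castSucc_succ]; trivial
  induction hσ using Submonoid.closure_induction with
  | mem σ hσ =>
    obtain ⟨i, rfl⟩ := hσ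
    obtain ⟨b, hb, hbi⟩ := h.exists_mem i
    exact ⟨_, transvectionEquiv_mem hΩ hb, fun x => h.map_transvection x hbi⟩
  | one => exact ⟨1, one_mem _, fun x => rfl⟩
  | mul σ τ _ _ hσ hτ =>
    obtain ⟨g, hg, hgx⟩ := hσ
    obtain ⟨g', hg', hgx'⟩ := hτ
    refine ⟨g' * g, mul_mem hg' hg, fun x => ?_⟩
    rw [LinearEquiv.mul_apply, hgx', hgx]
    rfl

lemma hammingNorm_apply_of_mem_gamma (h : IsEvenCoordinates Ω B m k φ) {g : V ≃ₗ[ZMod 2] V}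
    (hg : g ∈ Gamma Ω B) (x : V) : hammingNorm (φ (g x)) = hammingNorm (φ x) := by
  induction hg using Subgroup.closure_induction generalizing x with
  | mem g hg =>
    obtain ⟨b, hb, hgx⟩ := hg
    obtain ⟨i, hi⟩ := h.exists_edgeVec b hb
    rw [hgx, h.map_transvection x hi, hammingNorm_comp_perm]
  | one => rfl
  | mul g g' _ _ hg hg' => rw [LinearEquiv.mul_apply, hg, hg']
  | inv g _ hg =>
    rw [← hg (g⁻¹ x)]
    exact congrArg (fun y => hammingNorm (φ y)) (g.apply_symm_apply x)

lemma apply_eq_self_of_mem_ker (h : IsEvenCoordinates Ω B m k φ) {x : V}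
    (hx : x ∈ LinearMap.ker Ω) {g : V ≃ₗ[ZMod 2] V} (hg : g ∈ Gamma Ω B) : g x = x := by
  induction hg using Subgroup.closure_induction with
  | mem g hg =>
    obtain ⟨b, hb, hgx⟩ := hg
    rw [hgx, (h.mem_ker_iff x).1 hx b hb, zero_smul, add_zero]
  | one => rfl
  | mul g g' _ _ hg hg' => rw [LinearEquiv.mul_apply, hg', hg]
  | inv g _ hg => exact (LinearEquiv.symm_apply_eq g).2 hg.symm

lemma exists_apply_ne (h : IsEvenCoordinates Ω B m k φ) (hΩ : ∀ x : V, Ω x x = 0) {x : V}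
    (hx : x ∉ LinearMap.ker Ω) : ∃ g ∈ Gamma Ω B, g x ≠ x := by
  rw [h.mem_ker_iff] at hx
  push Not at hx
  obtain ⟨b, hb, hxb⟩ := hx
  refine ⟨_, transvectionEquiv_mem hΩ hb, fun hfix => ?_⟩
  rw [transvectionEquiv_apply, zmod_two_eq_one_of_ne_zero hxb, one_smul, add_eq_left] at hfix
  rw [hfix, map_zero] at hxb
  exact hxb rfl

lemma setOf_fixed_eq (h : IsEvenCoordinates Ω B m k φ) (hΩ : ∀ x : V, Ω x x = 0) :
    {x : V | ∀ g ∈ Gamma Ω B, g x = x} = LinearMap.ker Ω := by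
  ext x
  refine ⟨fun hx => ?_, fun hx g hg => h.apply_eq_self_of_mem_ker hx hg⟩
  by_contra hker
  obtain ⟨g, hg, hgx⟩ := h.exists_apply_ne hΩ hker
  exact hgx (hx g hg)

lemma sameOrbit_add_of_mem_ker (h : IsEvenCoordinates Ω B m k φ) (hΩ : ∀ x : V, Ω x x = 0)
    {x z : V} (hx : x ∉ LinearMap.ker Ω) (hz : z ∈ LinearMap.ker φ) :
    SameOrbit Ω B x (x + z) := by
  have hz' := h.ker_le hz
  clear hz
  induction hz' using Submodule.span_induction generalizing x with
  | mem z hz =>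
    obtain ⟨b, hb, b', hb', hbb, rfl⟩ := hz
    obtain ⟨i, hi⟩ := h.exists_edgeVec b hb
    have hker : b + b' ∈ LinearMap.ker Ω := by
      refine h.ker_le_ker ?_
      rw [LinearMap.mem_ker, map_add, hbb, ZModModule.add_self]
    rw [h.mem_ker_iff_constant] at hx
    push Not at hx
    obtain ⟨p, q, hpq⟩ := hx
    have hpq' : p ≠ q := fun e => hpq (by rw [e])
    obtain ⟨σ, hσp, hσq⟩ := MulAction.is_two_pretransitive_iff.1
      (Equiv.Perm.isMultiplyPretransitive (Fin (m + 2)) 2)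
      (Fin.castSucc_lt_succ (i := i)).ne hpq'
    obtain ⟨g, hg, hgx⟩ := h.exists_mem_gamma hΩ σ
    have hdot : φ (g x) ⬝ᵥ edgeVec i = 1 := by
      rw [dotProduct_edgeVec, hgx]
      refine zmod_two_eq_one_of_ne_zero fun e => hpq ?_
      rw [CharTwo.add_eq_zero, Function.comp_apply, Function.comp_apply] at e
      rwa [← hσp, ← hσq]
    have hgb : Ω (g x) b = 1 := by rw [h.form, hi, hdot]
    have hgb' : Ω (g x) b' = 1 := by rw [h.form, ← hbb, hi, hdot]
    have hbb' : Ω b b' = 0 := by rw [h.form, ← hbb, ← h.form, hΩ]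
    have h1 : SameOrbit Ω B (g x) (g x + (b + b')) := by
      have h1 := sameOrbit_transvection hΩ hb (g x)
      have h2 := sameOrbit_transvection hΩ hb' (g x + b)
      rw [hgb, one_smul] at h1
      rw [map_add, LinearMap.add_apply, hgb', hbb', add_zero, one_smul] at h2
      rw [← add_assoc]
      exact h1.trans h2
    have h2 : SameOrbit Ω B (x + (b + b')) (g x + (b + b')) := by
      refine ⟨g, hg, ?_⟩
      rw [map_add, h.apply_eq_self_of_mem_ker hker hg]
    exact (SameOrbit.trans ⟨g, hg, rfl⟩ h1).trans h2.symm
  | zero => rw [add_zero]; exact .refl _ _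
  | add z z' hz _ ih ih' =>
    have hker : Submodule.span (ZMod 2) {z | ∃ b ∈ B, ∃ b' ∈ B, φ b = φ b' ∧ z = b + b'} ≤
        LinearMap.ker Ω := by
      refine Submodule.span_le.2 ?_
      rintro _ ⟨b, -, b', -, hbb, rfl⟩
      refine h.ker_le_ker ?_
      rw [LinearMap.mem_ker, map_add, hbb, ZModModule.add_self]
    rw [← add_assoc]
    exact (ih hx).trans (ih' fun hmem => hx (by simpa using sub_mem hmem (hker hz)))
  | smul t z _ ih =>
    by_cases ht : t = 0
    · rw [ht, zero_smul, add_zero]; exact .refl _ _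
    · rw [zmod_two_eq_one_of_ne_zero ht, one_smul]; exact ih hx

lemma sameOrbit_iff (h : IsEvenCoordinates Ω B m k φ) (hΩ : ∀ x : V, Ω x x = 0) {x y : V}
    (hx : x ∉ LinearMap.ker Ω) :
    SameOrbit Ω B x y ↔ hammingNorm (φ y) = hammingNorm (φ x) := by
  constructor
  · rintro ⟨g, hg, rfl⟩
    exact h.hammingNorm_apply_of_mem_gamma hg x
  · intro hxy
    obtain ⟨σ, hσ⟩ := exists_perm_of_hammingNorm_eq hxy.symm
    obtain ⟨g, hg, hgx⟩ := h.exists_mem_gamma hΩ σ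
    have hz : g x + y ∈ LinearMap.ker φ := by
      rw [LinearMap.mem_ker, map_add, hgx, hσ, ZModModule.add_self]
    have hgx' : g x ∉ LinearMap.ker Ω := by
      rwa [h.mem_ker_iff_hammingNorm, h.hammingNorm_apply_of_mem_gamma hg, ← h.mem_ker_iff_hammingNorm]
    have := h.sameOrbit_add_of_mem_ker hΩ hgx' hz
    rw [← add_assoc, ZModModule.add_self, zero_add] at this
    exact SameOrbit.trans ⟨g, hg, rfl⟩ this

lemma ncard_nontrivial_orbits [Finite V] (h : IsEvenCoordinates Ω B m k φ)
    (hΩ : ∀ x : V, Ω x x = 0) :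
    {O : Set V | (∃ x : V, O = {y | SameOrbit Ω B x y}) ∧ 1 < O.ncard}.ncard = (m + 1) / 2 := by
  have hex : ∀ i < (m + 1) / 2, ∃ x, hammingNorm (φ x) = 2 * (i + 1) := fun i hi => by
    obtain ⟨v, hv⟩ := exists_hammingNorm_eq (n := m + 2) (w := 2 * (i + 1)) (by omega)
    obtain ⟨x, rfl⟩ := h.exists_preimage v (by
      rw [sum_eq_hammingNorm, hv, ZMod.natCast_eq_zero_iff_even]
      exact even_two_mul _)
    exact ⟨x, hv⟩
  have heq : {O : Set V | (∃ x : V, O = {y | SameOrbit Ω B x y}) ∧ 1 < O.ncard} =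
      (fun i => {x | hammingNorm (φ x) = 2 * (i + 1)}) '' Set.Iio ((m + 1) / 2) := by
    ext O
    constructor
    · rintro ⟨⟨x, rfl⟩, hcard⟩
      have hx : x ∉ LinearMap.ker Ω := by
        intro hx
        obtain ⟨y, ⟨g, hg, rfl⟩, hne⟩ := Set.exists_ne_of_one_lt_ncard hcard x
        exact hne (h.apply_eq_self_of_mem_ker hx hg)
      have hx' := hx
      rw [h.mem_ker_iff_hammingNorm] at hx'
      obtain ⟨w, hw⟩ := h.even_hammingNorm x
      have hle : hammingNorm (φ x) ≤ m + 2 := by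
        simpa using hammingNorm_le_card_fintype (x := φ x)
      refine ⟨w - 1, by rw [Set.mem_Iio]; omega, ?_⟩
      ext y
      rw [Set.mem_ofPred_eq, Set.mem_ofPred_eq, h.sameOrbit_iff hΩ hx]
      omega
    · rintro ⟨i, hi, rfl⟩
      rw [Set.mem_Iio] at hi
      obtain ⟨x, hxw⟩ := hex i hi
      have hx : x ∉ LinearMap.ker Ω := by
        rw [h.mem_ker_iff_hammingNorm]
        omega
      have hO : {y | hammingNorm (φ y) = 2 * (i + 1)} = {y | SameOrbit Ω B x y} := by
        ext y
        rw [Set.mem_ofPred_eq, Set.mem_ofPred_eq, h.sameOrbit_iff hΩ hx, hxw]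
      refine ⟨⟨x, hO⟩, ?_⟩
      obtain ⟨g, hg, hgx⟩ := h.exists_apply_ne hΩ hx
      beta_reduce
      rw [hO, Set.one_lt_ncard]
      exact ⟨g x, ⟨g, hg, rfl⟩, x, .refl _ _, hgx⟩
  rw [heq, Set.InjOn.ncard_image, ← Finset.coe_Iio, Set.ncard_coe_finset, Nat.card_Iio]
  intro i hi j _ hij
  obtain ⟨x, hx⟩ := hex i hi
  have : hammingNorm (φ x) = 2 * (j + 1) := (Set.ext_iff.1 hij x).1 hx
  omega

lemma finrank_ker_of_odd (h : IsEvenCoordinates Ω B m k φ) (hm : Odd m) :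
    Module.finrank (ZMod 2) (LinearMap.ker Ω) = k - 1 := by
  suffices hker : LinearMap.ker Ω = LinearMap.ker φ by rw [hker, h.finrank_ker]
  refine le_antisymm (fun x hx => ?_) h.ker_le_ker
  have heven := h.even_hammingNorm x
  rw [h.mem_ker_iff_hammingNorm] at hx
  rcases hx with hx | hx
  · exact hammingNorm_eq_zero.1 hx
  · rw [hx] at heven
    exact absurd heven (by rw [Nat.not_even_iff_odd]; exact hm.add_even even_two)

lemma finrank_ker_of_even [FiniteDimensional (ZMod 2) V] (h : IsEvenCoordinates Ω B m k φ)
    (hm : Even m) (hk : 1 ≤ k) : Module.finrank (ZMod 2) (LinearMap.ker Ω) = k := by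
  obtain ⟨x, hx⟩ := h.exists_preimage 1 (by
    obtain ⟨r, rfl⟩ := hm
    simp [← two_mul, CharTwo.two_eq_zero])
  have hx0 : x ≠ 0 := by
    rintro rfl
    simpa using congrFun hx 0
  have hsup : LinearMap.ker Ω = LinearMap.ker φ ⊔ Submodule.span (ZMod 2) {x} := by
    refine le_antisymm (fun y hy => ?_) (sup_le h.ker_le_ker ?_)
    · rw [h.mem_ker_iff_constant] at hy
      refine Submodule.mem_sup.2 ⟨y - φ y 0 • x, ?_, φ y 0 • x,
        Submodule.smul_mem _ _ (Submodule.mem_span_singleton_self x), sub_add_cancel _ _⟩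
      rw [LinearMap.mem_ker, map_sub, map_smul, hx]
      ext i
      simp [hy i 0]
    · rw [Submodule.span_singleton_le_iff_mem, h.mem_ker_iff_constant, hx]
      simp
  have hinf : LinearMap.ker φ ⊓ Submodule.span (ZMod 2) {x} = ⊥ := by
    rw [Submodule.eq_bot_iff]
    rintro y ⟨hy, hyx⟩
    obtain ⟨t, rfl⟩ := Submodule.mem_span_singleton.1 hyx
    have := congrFun (LinearMap.mem_ker.1 hy) 0
    rw [map_smul, hx] at this
    simp only [Pi.smul_apply, Pi.one_apply, smul_eq_mul, mul_one, Pi.zero_apply] at this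
    rw [this, zero_smul]
  have := Submodule.finrank_sup_add_finrank_inf_eq (LinearMap.ker φ)
    (Submodule.span (ZMod 2) {x})
  rw [← hsup, hinf, finrank_bot, h.finrank_ker, finrank_span_singleton hx0] at this
  omega

lemma hammingNorm_of_mem (h : IsEvenCoordinates Ω B m k φ) {b : V} (hb : b ∈ B) :
    hammingNorm (φ b) = 2 := by
  obtain ⟨i, hi⟩ := h.exists_edgeVec b hb
  rw [hi, hammingNorm_edgeVec]

lemma mem_delta_iff (h : IsEvenCoordinates Ω B m k φ) (hΩ : ∀ x : V, Ω x x = 0) (hm : 2 ≤ m)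
    {x : V} : x ∈ Delta Ω B ↔ hammingNorm (φ x) = 2 := by
  have key : ∀ b ∈ B, SameOrbit Ω B b x ↔ hammingNorm (φ x) = 2 := fun b hb => by
    rw [h.sameOrbit_iff hΩ, h.hammingNorm_of_mem hb]
    rw [h.mem_ker_iff_hammingNorm, h.hammingNorm_of_mem hb]
    omega
  constructor
  · rintro ⟨b, hb, hbx⟩
    exact (key b hb).1 hbx
  · intro hx
    obtain ⟨b, hb, -⟩ := h.exists_mem 0
    exact ⟨b, hb, (key b hb).2 hx⟩

lemma ker_subset_V000set (h : IsEvenCoordinates Ω B m k φ) (hΩ : ∀ x : V, Ω x x = 0)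
    (hm : 2 ≤ m) : (LinearMap.ker φ : Set V) ⊆ V000set Ω B := by
  intro y hy
  obtain ⟨b, hb, -⟩ := h.exists_mem 0
  have hy' : Ω y = 0 := h.ker_le_ker hy
  refine ⟨fun v => by rw [hy']; rfl, y + b, ?_, b, ?_, ?_⟩
  · rw [h.mem_delta_iff hΩ hm, map_add, LinearMap.mem_ker.1 hy, zero_add, h.hammingNorm_of_mem hb]
  · rw [h.mem_delta_iff hΩ hm, h.hammingNorm_of_mem hb]
  · rw [add_assoc, ZModModule.add_self, add_zero]

lemma V000set_eq_of_two_lt (h : IsEvenCoordinates Ω B m k φ) (hΩ : ∀ x : V, Ω x x = 0)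
    (hm : 2 < m) : V000set Ω B = LinearMap.ker φ := by
  refine Set.Subset.antisymm ?_ (h.ker_subset_V000set hΩ hm.le)
  rintro y ⟨hy, x₁, hx₁, x₂, hx₂, rfl⟩
  rw [h.mem_delta_iff hΩ hm.le] at hx₁ hx₂
  have hle := hammingNorm_add_le (φ x₁) (φ x₂)
  rw [← map_add] at hle
  have hy' : x₁ + x₂ ∈ LinearMap.ker Ω := LinearMap.ext hy
  rw [h.mem_ker_iff_hammingNorm] at hy'
  exact hammingNorm_eq_zero.1 (show hammingNorm (φ (x₁ + x₂)) = 0 by omega)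

lemma V000set_eq_of_eq_two {φ : V →ₗ[ZMod 2] (Fin (2 + 2) → ZMod 2)}
    (h : IsEvenCoordinates Ω B 2 k φ) (hΩ : ∀ x : V, Ω x x = 0) :
    V000set Ω B = LinearMap.ker Ω := by
  refine Set.Subset.antisymm (fun y hy => LinearMap.ext hy.1) fun y hy => ?_
  have hconst := (h.mem_ker_iff_constant y).1 hy
  by_cases h0 : φ y 0 = 0
  · refine h.ker_subset_V000set hΩ le_rfl ?_
    exact LinearMap.mem_ker.2 (funext fun i => by rw [hconst i 0, h0]; rfl)
  · have h1 : φ y = 1 := funext fun i => by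
      rw [hconst i 0, zmod_two_eq_one_of_ne_zero h0]; rfl
    obtain ⟨b, hb, hb0⟩ := h.exists_mem 0
    refine ⟨fun v => by rw [LinearMap.mem_ker.1 hy]; rfl, y + b, ?_, b, ?_, ?_⟩
    · rw [h.mem_delta_iff hΩ le_rfl, map_add, h1, hb0]
      decide
    · rw [h.mem_delta_iff hΩ le_rfl, h.hammingNorm_of_mem hb]
    · rw [add_assoc, ZModModule.add_self, add_zero]

end IsEvenCoordinates

/-! ### Existence of coordinates -/

section Existence

variable {m k : ℕ}

/-- The position of the left end of the pair attached to a vertex of the tree `D_{m,k}`. -/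
def treePos : Fin m ⊕ Fin k → Fin (m + 1)
  | Sum.inl i => i.castSucc
  | Sum.inr _ => Fin.last m

lemma dmkGraph_adj_iff (v w : Fin m ⊕ Fin k) :
    (DmkGraph m k).Adj v w ↔
      (treePos v).val + 1 = (treePos w).val ∨ (treePos w).val + 1 = (treePos v).val := by
  rcases v with i | i <;> rcases w with j | j <;>
    simp [DmkGraph, treePos, SimpleGraph.fromRel_adj, Fin.ext_iff] <;> omega

lemma edgeVec_dotProduct_edgeVec (p q : Fin (m + 1)) :
    edgeVec p ⬝ᵥ edgeVec q = if p.val + 1 = q.val ∨ q.val + 1 = p.val then 1 else 0 := by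
  rw [dotProduct_edgeVec]
  simp only [edgeVec, Pi.add_apply, Pi.single_apply, Fin.ext_iff, Fin.val_castSucc, Fin.val_succ]
  have h2 : (1 : ZMod 2) + 1 = 0 := rfl
  split_ifs <;> first | omega | simp [h2]

lemma range_sup_span_single_eq_top {φ : V →ₗ[ZMod 2] (Fin (m + 2) → ZMod 2)}
    (h : ∀ i, ∃ x, φ x = edgeVec i) :
    LinearMap.range φ ⊔ Submodule.span (ZMod 2) {Pi.single 0 1} = ⊤ := by
  set S := LinearMap.range φ ⊔ Submodule.span (ZMod 2) {Pi.single (0 : Fin (m + 2)) (1 : ZMod 2)}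
  have hS : ∀ i : Fin (m + 2), Pi.single i 1 ∈ S := fun i => by
    induction i using Fin.induction with
    | zero => exact Submodule.mem_sup_right (Submodule.mem_span_singleton_self _)
    | succ i ih =>
      obtain ⟨x, hx⟩ := h i
      have hmem : edgeVec i ∈ S := Submodule.mem_sup_left ⟨x, hx⟩
      simpa [edgeVec] using sub_mem hmem ih
  rw [eq_top_iff, ← (Pi.basisFun (ZMod 2) (Fin (m + 2))).span_eq, Submodule.span_le]
  rintro _ ⟨i, rfl⟩
  simpa using hS i

lemma exists_isEvenCoordinates [FiniteDimensional (ZMod 2) V] {Ω : BForm V}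
    (hΩ : ∀ x : V, Ω x x = 0) {B : Set V} (hspan : Submodule.span (ZMod 2) B = ⊤)
    (hcard : B.ncard ≤ Module.finrank (ZMod 2) V) (hk : 1 ≤ k) (e : Gr Ω B ≃g DmkGraph m k) :
    ∃ φ, IsEvenCoordinates Ω B m k φ := by
  let u : Fin m ⊕ Fin k → V := fun v => (e.symm v : V)
  have hu : ∀ v, u v ∈ B := fun v => (e.symm v).2
  have hrange : Set.range u = B := by
    ext b
    refine ⟨?_, fun hb => ⟨e ⟨b, hb⟩, by simp [u]⟩⟩
    rintro ⟨v, rfl⟩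
    exact hu v
  have hncard : B.ncard = m + k := by
    rw [← Nat.card_coe_set_eq, Nat.card_congr e.toEquiv]
    simp
  have hdim : Module.finrank (ZMod 2) V = m + k := by
    refine le_antisymm ?_ (hncard ▸ hcard)
    have := finrank_range_le_card (R := ZMod 2) u
    rw [hrange, Set.finrank, hspan, finrank_top] at this
    simpa using this
  let β := basisOfTopLeSpanOfCardEqFinrank u (by rw [hrange, hspan]) (by simp [hdim])
  have hβ : ∀ v, β v = u v := fun v => by simp [β]
  let φ : V →ₗ[ZMod 2] (Fin (m + 2) → ZMod 2) :=
    β.constr (ZMod 2) fun v => edgeVec (treePos v)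
  have hφ : ∀ v, φ (u v) = edgeVec (treePos v) := fun v => by
    rw [← hβ, Module.Basis.constr_basis]
  let c₀ : Fin k := ⟨0, hk⟩
  -- one vertex for each position along the path `a₁, …, a_m, c₁`
  let r : Fin (m + 1) → Fin m ⊕ Fin k := Fin.lastCases (Sum.inr c₀) Sum.inl
  have hr : ∀ i, treePos (r i) = i := fun i => by
    induction i using Fin.lastCases <;> simp [r, treePos]
  have hsup := range_sup_span_single_eq_top (φ := φ) fun i => ⟨u (r i), by rw [hφ, hr]⟩
  set K := Submodule.span (ZMod 2) {z | ∃ b ∈ B, ∃ b' ∈ B, φ b = φ b' ∧ z = b + b'} with hK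
  have hKle : K ≤ LinearMap.ker φ := by
    refine Submodule.span_le.2 ?_
    rintro _ ⟨b, -, b', -, hbb, rfl⟩
    rw [SetLike.mem_coe, LinearMap.mem_ker, map_add, hbb, ZModModule.add_self]
  have hKsup : K ⊔ Submodule.span (ZMod 2) (Set.range (u ∘ r)) = ⊤ := by
    rw [eq_top_iff, ← hspan, Submodule.span_le, ← hrange]
    rintro _ ⟨v, rfl⟩
    refine Submodule.mem_sup.2 ⟨u v + u (r (treePos v)), Submodule.subset_span
      ⟨_, hu _, _, hu _, by rw [hφ, hφ, hr], rfl⟩, u (r (treePos v)),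
      Submodule.subset_span ⟨_, rfl⟩, ?_⟩
    rw [add_assoc, ZModModule.add_self, add_zero]
  have hKdim : k - 1 ≤ Module.finrank (ZMod 2) K := by
    have h1 := Submodule.finrank_add_le_finrank_add_finrank K
      (Submodule.span (ZMod 2) (Set.range (u ∘ r)))
    have h2 := finrank_range_le_card (R := ZMod 2) (u ∘ r)
    rw [hKsup, finrank_top, hdim] at h1
    rw [Set.finrank, Fintype.card_fin] at h2
    omega
  have hkerdim : Module.finrank (ZMod 2) (LinearMap.ker φ) ≤ k - 1 := by
    have h1 := Submodule.finrank_add_le_finrank_add_finrank (LinearMap.range φ)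
      (Submodule.span (ZMod 2) {Pi.single 0 1})
    have h2 := finrank_span_singleton (K := ZMod 2)
      (v := (Pi.single 0 1 : Fin (m + 2) → ZMod 2)) (by simp)
    have h3 := φ.finrank_range_add_finrank_ker
    rw [hsup, finrank_top, Module.finrank_fin_fun, h2] at h1
    omega
  have hKeq : K = LinearMap.ker φ := Submodule.eq_of_le_of_finrank_le hKle (hkerdim.trans hKdim)
  have hform : Ω = (dotProductBilin (ZMod 2) (ZMod 2)).compl₁₂ φ φ := by
    refine β.ext fun v => β.ext fun w => ?_
    rw [hβ, hβ]
    change Ω (u v) (u w) = φ (u v) ⬝ᵥ φ (u w)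
    have hadj : (DmkGraph m k).Adj v w ↔ Ω (u v) (u w) = 1 := by
      rw [← e.symm.map_rel_iff]
      simp only [Gr, SimpleGraph.fromRel_adj]
      change _ ∧ (Ω (u v) (u w) = 1 ∨ Ω (u w) (u v) = 1) ↔ _
      rw [apply_swap_of_alternating hΩ (u w) (u v), or_self, and_iff_right_iff_imp]
      intro h1 h2
      have h3 : u v = u w := congrArg Subtype.val h2
      rw [h3, hΩ] at h1
      exact zero_ne_one h1
    rw [hφ, hφ, edgeVec_dotProduct_edgeVec]
    split_ifs with hpos
    · exact hadj.1 ((dmkGraph_adj_iff v w).2 hpos)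
    · by_contra hne
      exact hpos ((dmkGraph_adj_iff v w).1 (hadj.2 (zmod_two_eq_one_of_ne_zero hne)))
  have hedge : ∀ b ∈ B, ∃ i, φ b = edgeVec i := fun b hb => by
    rw [← hrange] at hb
    obtain ⟨v, rfl⟩ := hb
    exact ⟨_, hφ v⟩
  refine ⟨φ, fun x y => LinearMap.congr_fun₂ hform x y, hspan, hedge,
    fun i => ⟨u (r i), hu _, by rw [hφ, hr]⟩, fun v hv => ?_, hKeq.ge,
    le_antisymm hkerdim (hKeq ▸ hKdim)⟩
  obtain ⟨_, ⟨x, rfl⟩, z, hz, hxz⟩ := Submodule.mem_sup.1 (hsup ▸ Submodule.mem_top : v ∈ _)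
  obtain ⟨t, rfl⟩ := Submodule.mem_span_singleton.1 hz
  have hsum := sum_apply_eq_zero_of_span_eq_top hspan hedge x
  have ht : t = 0 := by
    rw [← hxz] at hv
    simpa [Finset.sum_add_distrib, hsum, Pi.single_apply] using hv
  exact ⟨x, by rw [← hxz, ht, zero_smul, add_zero]⟩

end Existence

/-- For a basis `B` equivalent to a basis whose graph is a tree of type
`D_{m,k}` (`m ≥ 2`, `k ≥ 1`): (i) `dim V₀₀₀ = k − 1` if `m > 2`, and
`dim V₀ = dim V₀₀₀ = k` if `m = 2`; (ii) the number of `Γ_B`-fixed vectors is `2^{k−1}`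
for `m` odd and `2^k` for `m` even; (iii) the number of `Γ_B`-orbits with more than one
element is `(m+1)/2` for `m` odd and `m/2` for `m` even. -/
theorem stmt_17 {V : Type*} [AddCommGroup V] [Module (ZMod 2) V]
    [FiniteDimensional (ZMod 2) V]
    (Ω : BForm V) (hΩ : ∀ x : V, Ω x x = 0)
    (B : Set V) (hB : IsBasisSet B)
    (m k : ℕ) (hm : 2 ≤ m) (hk : 1 ≤ k) (hequiv : EquivToDmkTree Ω B m k) :
    ((2 < m →
        Module.finrank (ZMod 2) (Submodule.span (ZMod 2) (V000set Ω B)) = k - 1) ∧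
      (m = 2 →
        Module.finrank (ZMod 2) (Submodule.span (ZMod 2) (V0set Ω)) = k ∧
        Module.finrank (ZMod 2) (Submodule.span (ZMod 2) (V000set Ω B)) = k)) ∧
    ((Odd m → {x : V | ∀ g ∈ Gamma Ω B, g x = x}.ncard = 2 ^ (k - 1)) ∧
      (Even m → {x : V | ∀ g ∈ Gamma Ω B, g x = x}.ncard = 2 ^ k)) ∧
    ((Odd m →
        {O : Set V | (∃ x : V, O = {y | SameOrbit Ω B x y}) ∧ 1 < O.ncard}.ncard
          = (m + 1) / 2) ∧
      (Even m →
        {O : Set V | (∃ x : V, O = {y | SameOrbit Ω B x y}) ∧ 1 < O.ncard}.ncard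
          = m / 2)) := by
  have : Finite V := Module.finite_of_finite (ZMod 2)
  obtain ⟨B', hBB', ⟨e⟩⟩ := hequiv
  obtain ⟨hG, hD, hspan, hcard⟩ := hBB'.invariants hΩ
  have hBcard : B.ncard = Module.finrank (ZMod 2) V := by
    rw [← Nat.card_coe_set_eq,
      Module.finrank_eq_nat_card_basis (Module.Basis.mk hB.1 (by simp [hB.2]))]
  obtain ⟨φ, h⟩ := exists_isEvenCoordinates hΩ (hspan ▸ hB.2) (hcard.trans hBcard.le) hk e
  have hV0 : V0set Ω = LinearMap.ker Ω := Set.ext fun x =>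
    ⟨fun hx => LinearMap.ext hx, fun hx v => by rw [LinearMap.mem_ker.1 hx]; rfl⟩
  have hV000 : V000set Ω B = V000set Ω B' := by rw [V000set, V000set, hD]
  have hO : SameOrbit Ω B = SameOrbit Ω B' := by
    ext x y
    rw [SameOrbit, SameOrbit, hG]
  have hncard : (LinearMap.ker Ω : Set V).ncard =
      2 ^ Module.finrank (ZMod 2) (LinearMap.ker Ω) := by
    rw [← Nat.card_coe_set_eq]
    simpa using Module.natCard_eq_pow_finrank (K := ZMod 2) (V := LinearMap.ker Ω)
  rw [hV000, hO, hG, hV0, h.setOf_fixed_eq hΩ, hncard, h.ncard_nontrivial_orbits hΩ,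
    Submodule.span_eq]
  refine ⟨⟨fun hm => ?_, ?_⟩, ⟨fun hm => ?_, fun hm => ?_⟩, fun _ => rfl, fun hm => ?_⟩
  · rw [h.V000set_eq_of_two_lt hΩ hm, Submodule.span_eq, h.finrank_ker]
  · rintro rfl
    rw [h.V000set_eq_of_eq_two hΩ, Submodule.span_eq, h.finrank_ker_of_even even_two hk]
    exact ⟨rfl, rfl⟩
  · rw [h.finrank_ker_of_odd hm]
  · rw [h.finrank_ker_of_even hm hk]
  · obtain ⟨r, rfl⟩ := hm
    omega
end

section
/- Let B⊆V be a linearly independent subset with Gr(B) connected, and suppose some subset X⊆B is equivalent to a linearly independent set whose graph is E₆. Then for any a,c∈B with Ω(a,c)=1, the set φ_{c,a}(B) contains a subset X' which is equivalent to a linearly independent set whose graph is E₆. -/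
open scoped BigOperators

variable {V : Type*} [AddCommGroup V] [Module (ZMod 2) V]

/-! ### Truth tables

A set of Boolean assignments `s` to the variables `0, …, n - 1` is stored as the natural number
whose bit at position `assignIndex n s` tells whether `s` belongs to the set. -/

/-- The position of the assignment `s` in a truth table with `n` variables. -/
def assignIndex : ℕ → (ℕ → Bool) → ℕ
  | 0, _ => 0
  | n + 1, s => assignIndex n s + if s n then 2 ^ n else 0

/-- The truth table with `n` variables of the variable `t`. -/
def varTable : ℕ → ℕ → ℕ
  | 0, _ => 0
  | n + 1, t =>
    if t = n then (2 ^ 2 ^ n - 1) <<< 2 ^ n else varTable n t ||| varTable n t <<< 2 ^ n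

/-- The truth table with `n + k` variables of a set that depends on the first `n` only. -/
def widenTable (n : ℕ) : ℕ → ℕ → ℕ
  | 0, T => T
  | k + 1, T => widenTable n k T ||| widenTable n k T <<< 2 ^ (n + k)

/-- The gate `(p, q, t)` adds the product of the variables `p` and `q` to the variable `t`. -/
def applyGate (g : ℕ × ℕ × ℕ) (s : ℕ → Bool) : ℕ → Bool :=
  Function.update s g.2.2 (xor (s g.2.2) (s g.1 && s g.2.1))

/-- Apply a list of gates from left to right. -/
def applyGates (w : List (ℕ × ℕ × ℕ)) (s : ℕ → Bool) : ℕ → Bool :=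
  w.foldl (fun s g => applyGate g s) s

/-- The preimage of a set of assignments under a gate, on truth tables. -/
def pullGate (n : ℕ) (g : ℕ × ℕ × ℕ) (T : ℕ) : ℕ :=
  T ^^^ ((varTable n g.1 &&& varTable n g.2.1) &&&
    (T ^^^ (T >>> 2 ^ g.2.2 ^^^ ((T >>> 2 ^ g.2.2 ^^^ T <<< 2 ^ g.2.2) &&& varTable n g.2.2))))

/-- The preimage of a set of assignments under a list of gates, on truth tables. -/
def pullGates (n : ℕ) (w : List (ℕ × ℕ × ℕ)) (T : ℕ) : ℕ :=
  w.foldr (pullGate n) T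

theorem assignIndex_lt (n : ℕ) (s : ℕ → Bool) : assignIndex n s < 2 ^ n := by
  induction n with
  | zero => simp [assignIndex]
  | succ n ih => simp only [assignIndex, pow_succ]; split <;> omega

theorem assignIndex_congr {n : ℕ} {s s' : ℕ → Bool} (h : ∀ t < n, s t = s' t) :
    assignIndex n s = assignIndex n s' := by
  induction n with
  | zero => rfl
  | succ n ih =>
    simp only [assignIndex, h n (Nat.lt_succ_self n), ih fun t ht => h t (Nat.lt_succ_of_lt ht)]

theorem testBit_assignIndex {n t : ℕ} (s : ℕ → Bool) (ht : t < n) :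
    (assignIndex n s).testBit t = s t := by
  induction n with
  | zero => omega
  | succ n ih =>
    have hlt := assignIndex_lt n s
    rcases Nat.lt_succ_iff_lt_or_eq.1 ht with h | rfl
    · simp only [assignIndex]
      split
      · rw [Nat.add_comm, Nat.testBit_two_pow_add_gt h, ih h]
      · simpa using ih h
    · cases hs : s t
      · simpa [assignIndex, hs] using Nat.testBit_lt_two_pow hlt
      · simp [assignIndex, hs, Nat.add_comm _ (2 ^ t), Nat.testBit_two_pow_add_eq,
          Nat.testBit_lt_two_pow hlt]

theorem assignIndex_update_of_le {n t : ℕ} (s : ℕ → Bool) (b : Bool) (ht : n ≤ t) :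
    assignIndex n (Function.update s t b) = assignIndex n s :=
  assignIndex_congr fun u hu => by simp [Function.update, (hu.trans_le ht).ne]

theorem assignIndex_update_true {n t : ℕ} {s : ℕ → Bool} (ht : t < n) (hs : s t = false) :
    assignIndex n (Function.update s t true) = 2 ^ t + assignIndex n s := by
  induction n with
  | zero => omega
  | succ n ih =>
    rcases Nat.lt_succ_iff_lt_or_eq.1 ht with h | rfl
    · simp [assignIndex, ih h, Function.update, h.ne', Nat.add_assoc]
    · simp [assignIndex, assignIndex_update_of_le, hs, Nat.add_comm]

theorem testBit_double {n T : ℕ} (hT : T < 2 ^ 2 ^ n) (s : ℕ → Bool) :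
    (T ||| T <<< 2 ^ n).testBit (assignIndex (n + 1) s) = T.testBit (assignIndex n s) := by
  have hlt := assignIndex_lt n s
  cases hs : s n
  · simp [assignIndex, hs, Nat.testBit_shiftLeft, hlt]
  · have h0 : T.testBit (assignIndex n s + 2 ^ n) = false :=
      Nat.testBit_lt_two_pow (hT.trans_le (Nat.pow_le_pow_right two_pos (by omega)))
    simp [assignIndex, hs, Nat.testBit_shiftLeft, h0]

theorem double_lt {n T : ℕ} (hT : T < 2 ^ 2 ^ n) : T ||| T <<< 2 ^ n < 2 ^ 2 ^ (n + 1) := by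
  refine Nat.or_lt_two_pow (hT.trans_le (Nat.pow_le_pow_right two_pos ?_)) ?_
  · exact Nat.pow_le_pow_right two_pos (Nat.le_succ n)
  · rw [Nat.shiftLeft_eq, pow_succ 2 n, mul_two, pow_add]
    exact Nat.mul_lt_mul_of_pos_right hT (by positivity)

theorem varTable_lt (n t : ℕ) : varTable n t < 2 ^ 2 ^ n := by
  induction n with
  | zero => simp [varTable]
  | succ n ih =>
    rw [varTable]
    split
    · rw [Nat.shiftLeft_eq, pow_succ 2 n, mul_two, pow_add]
      exact Nat.mul_lt_mul_of_pos_right (Nat.sub_lt (by positivity) one_pos) (by positivity)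
    · exact double_lt ih

theorem testBit_varTable {n t : ℕ} (s : ℕ → Bool) (ht : t < n) :
    (varTable n t).testBit (assignIndex n s) = s t := by
  induction n with
  | zero => omega
  | succ n ih =>
    rw [varTable]
    have hlt := assignIndex_lt n s
    split
    · subst t
      cases hs : s n <;> simp [assignIndex, hs, Nat.testBit_shiftLeft, hlt]
    · rw [testBit_double (varTable_lt n t), ih (by omega)]

theorem widenTable_lt {n T : ℕ} (k : ℕ) (hT : T < 2 ^ 2 ^ n) :
    widenTable n k T < 2 ^ 2 ^ (n + k) := by
  induction k with
  | zero => exact hT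
  | succ k ih => exact double_lt ih

theorem testBit_widenTable {n T : ℕ} (k : ℕ) (hT : T < 2 ^ 2 ^ n) (s : ℕ → Bool) :
    (widenTable n k T).testBit (assignIndex (n + k) s) = T.testBit (assignIndex n s) := by
  induction k with
  | zero => rfl
  | succ k ih => rw [← ih]; exact testBit_double (widenTable_lt k hT) s

theorem testBit_flip {n t : ℕ} (T : ℕ) (s : ℕ → Bool) (ht : t < n) :
    (T >>> 2 ^ t ^^^ ((T >>> 2 ^ t ^^^ T <<< 2 ^ t) &&& varTable n t)).testBit
      (assignIndex n s) = T.testBit (assignIndex n (Function.update s t (!s t))) := by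
  simp only [Nat.testBit_xor, Nat.testBit_and, testBit_varTable s ht]
  cases hs : s t
  · simp [Nat.testBit_shiftRight, assignIndex_update_true ht hs]
  · have h := assignIndex_update_true (s := Function.update s t false) ht (by simp)
    rw [Function.update_idem, ← hs, Function.update_eq_self] at h
    simp [h, Nat.testBit_shiftLeft]

theorem testBit_pullGate {n : ℕ} {g : ℕ × ℕ × ℕ} (T : ℕ) (s : ℕ → Bool)
    (hg : g.1 < n ∧ g.2.1 < n ∧ g.2.2 < n) :
    (pullGate n g T).testBit (assignIndex n s) = T.testBit (assignIndex n (applyGate g s)) := by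
  unfold pullGate
  rw [Nat.testBit_xor, Nat.testBit_and, Nat.testBit_and, Nat.testBit_xor,
    testBit_flip T s hg.2.2, testBit_varTable s hg.1, testBit_varTable s hg.2.1, applyGate]
  cases s g.1 && s g.2.1 <;> simp

theorem testBit_pullGates {n : ℕ} {w : List (ℕ × ℕ × ℕ)} (T : ℕ) (s : ℕ → Bool)
    (hw : ∀ g ∈ w, g.1 < n ∧ g.2.1 < n ∧ g.2.2 < n) :
    (pullGates n w T).testBit (assignIndex n s) =
      T.testBit (assignIndex n (applyGates w s)) := by
  induction w generalizing s with
  | nil => rfl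
  | cons g w ih =>
    rw [List.forall_mem_cons] at hw
    exact (testBit_pullGate _ s hw.1).trans (ih _ hw.2)

/-! ### Graphs as assignments

A graph on the vertices `0, 1, 2, …` is an assignment to the variables `edgeVar i j`. -/

/-- The variable of the edge between the distinct vertices `i` and `j`. -/
def edgeVar (i j : ℕ) : ℕ := if i < j then j * (j - 1) / 2 + i else i * (i - 1) / 2 + j

/-- The larger end of the edge with variable `t < 21`. -/
def edgeTop (t : ℕ) : ℕ := (List.range 6).countP fun j => (j + 1) * j / 2 ≤ t

/-- The smaller end of the edge with variable `t < 21`. -/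
def edgeBot (t : ℕ) : ℕ := t - edgeTop t * (edgeTop t - 1) / 2

/-- The vertices among `0, …, n - 1` different from `u` and `v`. -/
def otherVertices (n u v : ℕ) : List ℕ := (List.range n).filter fun i => i != u && i != v

/-- The effect on a graph of replacing the vector at `c` by its sum with the vector at `a`. -/
def moveGates (n a c : ℕ) : List (ℕ × ℕ × ℕ) :=
  (otherVertices n a c).map fun i => (edgeVar a c, edgeVar a i, edgeVar c i)

/-- The effect on a graph of replacing the vector at `v` by the one at `u`. -/
def copyGates (n u v : ℕ) : List (ℕ × ℕ × ℕ) :=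
  (otherVertices n u v).flatMap fun i =>
    [(edgeVar v i, edgeVar v i, edgeVar v i), (edgeVar u i, edgeVar u i, edgeVar v i)]

theorem edgeVar_comm (i j : ℕ) : edgeVar i j = edgeVar j i := by
  unfold edgeVar
  rcases lt_trichotomy i j with h | rfl | h
  · rw [if_pos h, if_neg h.asymm]
  · rfl
  · rw [if_neg h.asymm, if_pos h]

theorem edgeVar_ends : ∀ t < 21, edgeBot t < edgeTop t ∧ edgeTop t < 7 ∧
    edgeVar (edgeBot t) (edgeTop t) = t ∧ (t < 15 → edgeTop t < 6) := by
  decide +kernel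

theorem ends_edgeVar : ∀ j < 7, ∀ i < j,
    edgeBot (edgeVar i j) = i ∧ edgeTop (edgeVar i j) = j := by
  decide +kernel

theorem edgeVar_injective (i : ℕ) (hi : i < 7) (j : ℕ) (hj : j < 7) (hij : i ≠ j) (k : ℕ)
    (hk : k < 7) (l : ℕ) (hl : l < 7) (hkl : k ≠ l) (h : edgeVar i j = edgeVar k l) :
    i = k ∧ j = l ∨ i = l ∧ j = k := by
  have ends : ∀ i < 7, ∀ j < 7, i ≠ j →
      edgeBot (edgeVar i j) = i ∧ edgeTop (edgeVar i j) = j ∨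
        edgeBot (edgeVar i j) = j ∧ edgeTop (edgeVar i j) = i := fun i hi j hj hij => by
    rcases hij.lt_or_gt with h | h
    · exact .inl (ends_edgeVar j hj i h)
    · exact .inr (edgeVar_comm j i ▸ ends_edgeVar i hi j h)
  have h₁ := ends i hi j hj hij
  have h₂ := ends k hk l hl hkl
  rw [h] at h₁
  omega

theorem moveGates_six_lt : ∀ a < 6, ∀ c < 6, a ≠ c →
    ∀ g ∈ moveGates 6 a c, g.1 < 15 ∧ g.2.1 < 15 ∧ g.2.2 < 15 := by
  decide +kernel

theorem moveGates_seven_lt : ∀ c < 6,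
    ∀ g ∈ moveGates 7 6 c, g.1 < 21 ∧ g.2.1 < 21 ∧ g.2.2 < 21 := by
  decide +kernel

theorem copyGates_seven_lt : ∀ z < 6,
    ∀ g ∈ copyGates 7 6 z, g.1 < 21 ∧ g.2.1 < 21 ∧ g.2.2 < 21 := by
  decide +kernel

theorem mem_otherVertices {n u v i : ℕ} : i ∈ otherVertices n u v ↔ i < n ∧ i ≠ u ∧ i ≠ v := by
  simp [otherVertices]

theorem applyGates_eq_of_notMem {w : List (ℕ × ℕ × ℕ)} {u : ℕ} (s : ℕ → Bool)
    (h : ∀ g ∈ w, g.2.2 ≠ u) : applyGates w s u = s u := by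
  induction w generalizing s with
  | nil => rfl
  | cons g w ih =>
    rw [List.forall_mem_cons] at h
    exact (ih _ h.2).trans (Function.update_of_ne h.1.symm _ _)

theorem applyGates_map {l : List ℕ} {k : ℕ} {q t : ℕ → ℕ} (s : ℕ → Bool) (hl : l.Nodup)
    (hk : ∀ i ∈ l, t i ≠ k) (hq : ∀ i ∈ l, ∀ j ∈ l, t i ≠ q j)
    (ht : ∀ i ∈ l, ∀ j ∈ l, t i = t j → i = j) {i : ℕ} (hi : i ∈ l) :
    applyGates (l.map fun i => (k, q i, t i)) s (t i) = xor (s (t i)) (s k && s (q i)) := by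
  induction l generalizing s with
  | nil => simp at hi
  | cons j l ih =>
    have hstep : ∀ u, u ≠ t j → applyGate (k, q j, t j) s u = s u := fun u hu =>
      Function.update_of_ne hu _ _
    rw [List.nodup_cons] at hl
    rcases List.mem_cons.1 hi with rfl | hi
    · refine (applyGates_eq_of_notMem (w := l.map fun i => (k, q i, t i)) _ ?_).trans
        (Function.update_self _ _ _)
      simp only [List.mem_map, forall_exists_index, and_imp, forall_apply_eq_imp_iff₂]
      intro j hj h
      rw [ht j (by simp [hj]) i (by simp) h] at hj
      exact hl.1 hj
    · refine (ih (applyGate (k, q j, t j) s) hl.2 (fun i hi => hk i (by simp [hi]))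
        (fun i hi j hj => hq i (by simp [hi]) j (by simp [hj]))
        (fun i hi j hj => ht i (by simp [hi]) j (by simp [hj])) hi).trans ?_
      rw [hstep _ (hk j (by simp)).symm, hstep _ (hq j (by simp) i (by simp [hi])).symm, hstep]
      intro h
      rw [ht i (by simp [hi]) j (by simp) h] at hi
      exact hl.1 hi

theorem applyGates_copy {l : List ℕ} {q t : ℕ → ℕ} (s : ℕ → Bool) (hl : l.Nodup)
    (hq : ∀ i ∈ l, ∀ j ∈ l, t i ≠ q j)
    (ht : ∀ i ∈ l, ∀ j ∈ l, t i = t j → i = j) {i : ℕ} (hi : i ∈ l) :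
    applyGates (l.flatMap fun i => [(t i, t i, t i), (q i, q i, t i)]) s (t i) = s (q i) := by
  induction l generalizing s with
  | nil => simp at hi
  | cons j l ih =>
    have hstep : ∀ u, u ≠ t j →
        applyGate (q j, q j, t j) (applyGate (t j, t j, t j) s) u = s u := fun u hu =>
      (Function.update_of_ne hu _ _).trans (Function.update_of_ne hu _ _)
    rw [List.nodup_cons] at hl
    rcases List.mem_cons.1 hi with rfl | hi
    · refine (applyGates_eq_of_notMem
        (w := l.flatMap fun i => [(t i, t i, t i), (q i, q i, t i)]) _ ?_).trans ?_
      · intro g hg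
        obtain ⟨j, hj, hg⟩ := List.mem_flatMap.1 hg
        have hg : g.2.2 = t j := by
          simp only [List.mem_cons, List.not_mem_nil, or_false] at hg
          rcases hg with rfl | rfl <;> rfl
        rw [hg]
        intro h
        rw [ht j (by simp [hj]) i (by simp) h] at hj
        exact hl.1 hj
      · simp [applyGate, Function.update_of_ne (hq i (by simp) i (by simp)).symm]
    · refine (ih (applyGate (q j, q j, t j) (applyGate (t j, t j, t j) s)) hl.2
        (fun i hi j hj => hq i (by simp [hi]) j (by simp [hj]))
        (fun i hi j hj => ht i (by simp [hi]) j (by simp [hj])) hi).trans ?_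
      exact hstep _ (hq j (by simp) i (by simp [hi])).symm

theorem otherVertices_nodup (n u v : ℕ) : (otherVertices n u v).Nodup :=
  List.nodup_range.filter _

/-! ### The graph of a family of vectors -/

/-- Adjacency in `Gr`, as a truth value. -/
def adj (Ω : BForm V) (u v : V) : Bool := decide (Ω u v = 1)

/-- The graph of a family of vectors, as an assignment. -/
def graphAssign (Ω : BForm V) (x : ℕ → V) (t : ℕ) : Bool := adj Ω (x (edgeBot t)) (x (edgeTop t))

theorem form_comm {Ω : BForm V} (hΩ : ∀ x, Ω x x = 0) (u v : V) : Ω u v = Ω v u := by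
  have h := hΩ (u + v)
  simp only [map_add, LinearMap.add_apply, hΩ, zero_add, add_zero] at h
  exact (CharTwo.add_eq_zero.1 h).symm

theorem adj_comm {Ω : BForm V} (hΩ : ∀ x, Ω x x = 0) (u v : V) : adj Ω u v = adj Ω v u := by
  rw [adj, form_comm hΩ]; rfl

theorem adj_add_left (Ω : BForm V) (u v w : V) :
    adj Ω (u + v) w = xor (adj Ω u w) (adj Ω v w) := by
  have key : ∀ p q : ZMod 2, decide (p + q = 1) = xor (decide (p = 1)) (decide (q = 1)) := by
    decide
  simp [adj, key]

theorem adj_self {Ω : BForm V} (hΩ : ∀ x, Ω x x = 0) (u : V) : adj Ω u u = false := by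
  simp [adj, hΩ]

theorem graphAssign_edgeVar {Ω : BForm V} (hΩ : ∀ x, Ω x x = 0) (x : ℕ → V) {i j : ℕ}
    (hi : i < 7) (hj : j < 7) (hij : i ≠ j) :
    graphAssign Ω x (edgeVar i j) = adj Ω (x i) (x j) := by
  rcases hij.lt_or_gt with h | h
  · obtain ⟨h₁, h₂⟩ := ends_edgeVar j hj i h
    rw [graphAssign, h₁, h₂]
  · obtain ⟨h₁, h₂⟩ := ends_edgeVar i hi j h
    rw [edgeVar_comm, graphAssign, h₁, h₂, adj_comm hΩ]

theorem eq_edgeVar {n N t : ℕ} (hn : n = 6 ∧ N = 15 ∨ n = 7 ∧ N = 21) (ht : t < N) :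
    ∃ i j, i < n ∧ j < n ∧ i ≠ j ∧ t = edgeVar i j := by
  obtain ⟨h₁, h₂, h₃, h₄⟩ := edgeVar_ends t (by omega)
  refine ⟨_, _, ?_, ?_, h₁.ne, h₃.symm⟩ <;> rcases hn with ⟨rfl, rfl⟩ | ⟨rfl, rfl⟩ <;> omega

/-- Every edge either contains a given vertex `c` or does not. -/
theorem edgeVar_cases {n : ℕ} (c : ℕ) {i j : ℕ} (hi : i < n) (hj : j < n) (hij : i ≠ j) :
    (∃ k < n, k ≠ c ∧ edgeVar i j = edgeVar c k) ∨ i ≠ c ∧ j ≠ c := by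
  by_cases h : i = c
  · exact .inl ⟨j, hj, h ▸ hij.symm, by rw [h]⟩
  by_cases h' : j = c
  · exact .inl ⟨i, hi, h, by rw [h', edgeVar_comm]⟩
  exact .inr ⟨h, h'⟩

theorem applyGates_moveGates {Ω : BForm V} (hΩ : ∀ x, Ω x x = 0) {n N : ℕ}
    (hn : n = 6 ∧ N = 15 ∨ n = 7 ∧ N = 21) {a c : ℕ} (ha : a < n) (hc : c < n) (hac : a ≠ c)
    (x : ℕ → V) (h : adj Ω (x a) (x c) = true) {t : ℕ} (ht : t < N) :
    applyGates (moveGates n a c) (graphAssign Ω x) t =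
      graphAssign Ω (Function.update x c (x c + x a)) t := by
  have hn7 : n ≤ 7 := by omega
  obtain ⟨i, j, hi, hj, hij, rfl⟩ := eq_edgeVar hn ht
  have hother : ∀ k ∈ otherVertices n a c, k < 7 ∧ k ≠ a ∧ k ≠ c := fun k hk => by
    obtain ⟨h₁, h₂⟩ := mem_otherVertices.1 hk
    exact ⟨by omega, h₂⟩
  have hinj := edgeVar_injective
  rcases edgeVar_cases c hi hj hij with ⟨k, hk, hkc, he⟩ | ⟨hic, hjc⟩
  · rw [he, graphAssign_edgeVar hΩ _ (by omega) (by omega) hkc.symm, Function.update_self,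
      Function.update_of_ne hkc, adj_add_left]
    by_cases hka : k = a
    · subst hka
      rw [applyGates_eq_of_notMem, graphAssign_edgeVar hΩ _ (by omega) (by omega) hkc.symm,
        adj_self hΩ, Bool.xor_false]
      intro g hg
      obtain ⟨l, hl, rfl⟩ := List.mem_map.1 hg
      obtain ⟨h₁, h₂, h₃⟩ := hother l hl
      intro he'
      have := hinj c (by omega) l h₁ h₃.symm c (by omega) k (by omega) hkc.symm he'
      omega
    · have := applyGates_map (l := otherVertices n a c) (k := edgeVar a c) (q := edgeVar a)
        (t := edgeVar c) (graphAssign Ω x) (otherVertices_nodup n a c)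
        (fun i hi he' => by
          obtain ⟨h₁, h₂, h₃⟩ := hother i hi
          have := hinj c (by omega) i h₁ h₃.symm a (by omega) c (by omega) hac he'
          omega)
        (fun i hi j hj he' => by
          obtain ⟨h₁, h₂, h₃⟩ := hother i hi
          obtain ⟨h₁', h₂', h₃'⟩ := hother j hj
          have := hinj c (by omega) i h₁ h₃.symm a (by omega) j h₁' h₂'.symm he'
          omega)
        (fun i hi j hj he' => by
          obtain ⟨h₁, h₂, h₃⟩ := hother i hi
          obtain ⟨h₁', h₂', h₃'⟩ := hother j hj
          have := hinj c (by omega) i h₁ h₃.symm c (by omega) j h₁' h₃'.symm he'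
          omega)
        (mem_otherVertices.2 ⟨hk, hka, hkc⟩)
      rw [moveGates, this, graphAssign_edgeVar hΩ _ (by omega) (by omega) hkc.symm,
        graphAssign_edgeVar hΩ _ (by omega) (by omega) hac,
        graphAssign_edgeVar hΩ _ (by omega) (by omega) (Ne.symm hka), h, Bool.true_and]
  · rw [applyGates_eq_of_notMem, graphAssign_edgeVar hΩ _ (by omega) (by omega) hij,
      graphAssign_edgeVar hΩ _ (by omega) (by omega) hij, Function.update_of_ne hic,
      Function.update_of_ne hjc]
    intro g hg
    obtain ⟨l, hl, rfl⟩ := List.mem_map.1 hg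
    obtain ⟨h₁, h₂, h₃⟩ := hother l hl
    intro he'
    have := hinj c (by omega) l h₁ h₃.symm i (by omega) j (by omega) hij he'
    omega

theorem applyGates_moveGates_of_not_adj {Ω : BForm V} (hΩ : ∀ x, Ω x x = 0) {n a c : ℕ}
    (ha : a < 7) (hc : c < 7) (hac : a ≠ c) (x : ℕ → V) (h : adj Ω (x a) (x c) = false) :
    applyGates (moveGates n a c) (graphAssign Ω x) = graphAssign Ω x := by
  unfold moveGates
  induction otherVertices n a c with
  | nil => rfl
  | cons i l ih =>
    have : applyGate (edgeVar a c, edgeVar a i, edgeVar c i) (graphAssign Ω x) =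
        graphAssign Ω x := by
      simp [applyGate, graphAssign_edgeVar hΩ x ha hc hac, h]
    simpa [applyGates, this] using ih

theorem applyGates_copyGates {Ω : BForm V} (hΩ : ∀ x, Ω x x = 0) {z : ℕ} (hz : z < 6)
    (x : ℕ → V) {t : ℕ} (ht : t < 15) :
    applyGates (copyGates 7 6 z) (graphAssign Ω x) t =
      graphAssign Ω (Function.update x z (x 6)) t := by
  obtain ⟨i, j, hi, hj, hij, rfl⟩ := eq_edgeVar (.inl ⟨rfl, rfl⟩) ht
  have hinj := edgeVar_injective
  rcases edgeVar_cases z hi hj hij with ⟨k, hk, hkz, he⟩ | ⟨hiz, hjz⟩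
  · have := applyGates_copy (l := otherVertices 7 6 z) (q := edgeVar 6)
      (t := edgeVar z) (graphAssign Ω x) (otherVertices_nodup 7 6 z)
      (fun i hi j hj he' => by
        obtain ⟨h₁, h₂, h₃⟩ := mem_otherVertices.1 hi
        obtain ⟨h₁', h₂', h₃'⟩ := mem_otherVertices.1 hj
        have := hinj z (by omega) i h₁ h₃.symm 6 (by omega) j h₁' h₂'.symm he'
        omega)
      (fun i hi j hj he' => by
        obtain ⟨h₁, h₂, h₃⟩ := mem_otherVertices.1 hi
        obtain ⟨h₁', h₂', h₃'⟩ := mem_otherVertices.1 hj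
        have := hinj z (by omega) i h₁ h₃.symm z (by omega) j h₁' h₃'.symm he'
        omega)
      (mem_otherVertices.2 ⟨by omega, by omega, hkz⟩ : k ∈ otherVertices 7 6 z)
    rw [he, copyGates, this, graphAssign_edgeVar hΩ _ (by omega) (by omega) (by omega),
      graphAssign_edgeVar hΩ _ (by omega) (by omega) hkz.symm, Function.update_self,
      Function.update_of_ne hkz]
  · rw [applyGates_eq_of_notMem, graphAssign_edgeVar hΩ _ (by omega) (by omega) hij,
      graphAssign_edgeVar hΩ _ (by omega) (by omega) hij, Function.update_of_ne hiz,
      Function.update_of_ne hjz]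
    intro g hg
    obtain ⟨l, hl, hg⟩ := List.mem_flatMap.1 hg
    obtain ⟨h₁, h₂, h₃⟩ := mem_otherVertices.1 hl
    have hg : g.2.2 = edgeVar z l := by
      simp only [List.mem_cons, List.not_mem_nil, or_false] at hg
      rcases hg with rfl | rfl <;> rfl
    rw [hg]
    intro he'
    have := hinj z (by omega) l h₁ h₃.symm i (by omega) j (by omega) hij he'
    omega

/-! ### The class of `E₆` -/

/-- The graph `E₆`, as an assignment index. -/
def e6Index : ℕ :=
  2 ^ edgeVar 0 1 + 2 ^ edgeVar 1 2 + 2 ^ edgeVar 2 3 + 2 ^ edgeVar 3 4 + 2 ^ edgeVar 2 5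

/-- The ordered pairs of distinct vertices among `0, …, 5`. -/
def vertexPairs : List (ℕ × ℕ) :=
  (List.range 6 ×ˢ List.range 6).filter fun m => m.1 != m.2

/-- Add to a set of graphs on six vertices all graphs obtained from it by a basic move, going
through the moves one after the other. -/
def sweepMoves (T : ℕ) : ℕ :=
  vertexPairs.foldl (fun T m => T ||| pullGates 15 (moveGates 6 m.1 m.2) T) T

/-- The truth table of the graphs on six vertices equivalent to `E₆`. -/
def e6Table : ℕ := sweepMoves (sweepMoves (sweepMoves (2 ^ e6Index)))

/-- The graphs on seven vertices for which the graph on the first six is equivalent to `E₆`. -/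
def e6WideTable : ℕ := widenTable 15 6 e6Table

/-- The graphs on seven vertices having a six-vertex subgraph equivalent to `E₆`. -/
def e6SubTable : ℕ :=
  (List.range 6).foldl (fun G z => G ||| pullGates 21 (copyGates 7 6 z) e6WideTable) e6WideTable

theorem e6Table_lt : e6Table < 2 ^ 2 ^ 15 := by
  decide +kernel

theorem pullGates_e6Table :
    ∀ m ∈ vertexPairs, pullGates 15 (moveGates 6 m.1 m.2) e6Table = e6Table := by
  decide +kernel

theorem testBit_e6Index_e6Table : e6Table.testBit e6Index = true := by
  decide +kernel

theorem e6WideTable_and_pullGates : ∀ c < 6,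
    (e6WideTable &&& varTable 21 (edgeVar 6 c)) &&& pullGates 21 (moveGates 7 6 c) e6SubTable =
      e6WideTable &&& varTable 21 (edgeVar 6 c) := by
  decide +kernel

theorem mem_vertexPairs {m : ℕ × ℕ} : m ∈ vertexPairs ↔ m.1 < 6 ∧ m.2 < 6 ∧ m.1 ≠ m.2 := by
  obtain ⟨i, j⟩ := m
  simp [vertexPairs, and_assoc]

/-! ### Moves on linearly independent families -/

theorem LinearIndependent.update_add {ι : Type*} [DecidableEq ι] {v : ι → V}
    (hv : LinearIndependent (ZMod 2) v) {a c : ι} (hac : a ≠ c) :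
    LinearIndependent (ZMod 2) (Function.update v c (v c + v a)) := by
  have h : Function.update v c (v c + v a) =
      v + fun i => (if i = c then (1 : ZMod 2) else 0) • v a := by
    funext i
    by_cases hi : i = c
    · subst hi; simp
    · simp [hi]
  rw [h]
  have key := @linearIndependent_add_smul_iff ι (ZMod 2) V _ _ _ v
    (fun i => if i = c then (1 : ZMod 2) else 0) a (if_neg hac)
  exact key.2 hv

theorem Function.Injective.range_update {α β : Type*} [DecidableEq α] {f : α → β}
    (hf : Function.Injective f) (c : α) (w : β) :
    Set.range (Function.update f c w) = insert w (Set.range f \ {f c}) := by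
  ext y
  constructor
  · rintro ⟨i, rfl⟩
    by_cases hi : i = c
    · subst hi; simp
    · rw [Function.update_of_ne hi]
      exact .inr ⟨⟨i, rfl⟩, fun h => hi (hf h)⟩
  · rintro (rfl | ⟨⟨i, rfl⟩, hi⟩)
    · exact ⟨c, Function.update_self _ _ _⟩
    · exact ⟨i, Function.update_of_ne (fun h => hi (congrArg f h)) _ _⟩

theorem update_comp_finVal {W : Type*} {n : ℕ} (x : ℕ → W) (c : Fin n) (w : W) :
    (fun i : Fin n => Function.update x c w i) = Function.update (fun i : Fin n => x i) c w :=
  Function.update_comp_eq_of_injective x Fin.val_injective c w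

/-- `x` restricted to `0, …, n - 1` is linearly independent. -/
def IndepFamily (n : ℕ) (x : ℕ → V) : Prop := LinearIndependent (ZMod 2) fun i : Fin n => x i

/-- The vectors `x 0, …, x (n - 1)`. -/
def familySet (n : ℕ) (x : ℕ → V) : Set V := Set.range fun i : Fin n => x i

theorem IndepFamily.update_add {n : ℕ} {x : ℕ → V} (hx : IndepFamily n x) {a c : ℕ} (ha : a < n)
    (hc : c < n) (hac : a ≠ c) : IndepFamily n (Function.update x c (x c + x a)) := by
  have h := LinearIndependent.update_add hx (a := ⟨a, ha⟩) (c := ⟨c, hc⟩) (by simpa using hac)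
  rwa [← update_comp_finVal] at h

theorem IndepFamily.familySet_update {n : ℕ} {x : ℕ → V} (hx : IndepFamily n x) {c : ℕ}
    (hc : c < n) (w : V) :
    familySet n (Function.update x c w) = insert w (familySet n x \ {x c}) := by
  have h := (LinearIndependent.injective hx).range_update ⟨c, hc⟩ w
  rwa [← update_comp_finVal] at h

theorem linearIndependent_move {X : Set V} (hX : LinearIndependent (ZMod 2) (Subtype.val : X → V))
    {a c : V} (ha : a ∈ X) (hc : c ∈ X) (hac : a ≠ c) :
    LinearIndependent (ZMod 2) (Subtype.val : ↥(insert (c + a) (X \ {c})) → V) := by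
  classical
  have h := (LinearIndependent.update_add hX (a := ⟨a, ha⟩) (c := ⟨c, hc⟩)
    (by simpa using hac)).linearIndepOn_id
  rw [Subtype.val_injective.range_update, Subtype.range_val] at h
  exact h

theorem add_notMem_of_linearIndependent {X : Set V}
    (hX : LinearIndependent (ZMod 2) (Subtype.val : X → V)) {a c : V} (ha : a ∈ X) (hc : c ∈ X)
    (hac : a ≠ c) : c + a ∉ X := by
  classical
  intro h
  have hc0 : c ≠ 0 := hX.ne_zero ⟨c, hc⟩
  have ha0 : a ≠ 0 := hX.ne_zero ⟨a, ha⟩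
  have hne : c + a ≠ a := by simpa using hc0
  have hinj := (LinearIndependent.update_add hX (a := ⟨a, ha⟩) (c := ⟨c, hc⟩)
    (by simpa using hac)).injective
  have hne' : (⟨c + a, h⟩ : X) ≠ ⟨c, hc⟩ := by simpa using ha0
  refine hne' (hinj ?_)
  rw [Function.update_self, Function.update_of_ne hne']

theorem MoveRel.symm {Ω : BForm V} (hΩ : ∀ x, Ω x x = 0) {X Y : Set V}
    (hX : LinearIndependent (ZMod 2) (Subtype.val : X → V)) (h : MoveRel Ω X Y) :
    MoveRel Ω Y X := by
  obtain ⟨a, c, ha, hc, hac, hΩac, rfl⟩ := h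
  have hnot := add_notMem_of_linearIndependent hX ha hc hac
  refine ⟨a, c + a, .inr ⟨ha, hac⟩, .inl rfl, fun h => hnot (h ▸ ha), ?_, ?_⟩
  · simp [hΩ, hΩac]
  · have : c + a + a = c := by rw [add_assoc, ZModModule.add_self, add_zero]
    rw [this, Set.insert_sdiff_self_of_notMem fun h => hnot h.1, Set.insert_sdiff_singleton,
      Set.insert_eq_of_mem hc]

/-! ### Membership in the table characterizes equivalence with `E₆` -/

/-- `T` holds at the graph of `x 0, …, x 5`. -/
def InTable (Ω : BForm V) (T : ℕ) (x : ℕ → V) : Prop :=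
  T.testBit (assignIndex 15 (graphAssign Ω x)) = true

theorem inTable_pullGates {Ω : BForm V} (hΩ : ∀ x, Ω x x = 0) {a c : ℕ} (ha : a < 6) (hc : c < 6)
    (hac : a ≠ c) (T : ℕ) (x : ℕ → V) (h : Ω (x a) (x c) = 1) :
    InTable Ω (pullGates 15 (moveGates 6 a c) T) x ↔
      InTable Ω T (Function.update x c (x c + x a)) := by
  rw [InTable, testBit_pullGates _ _ (moveGates_six_lt a ha c hc hac), assignIndex_congr fun t ht =>
    applyGates_moveGates hΩ (.inl ⟨rfl, rfl⟩) ha hc hac x (decide_eq_true h) ht, InTable]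

theorem inTable_pullGates_of_ne {Ω : BForm V} (hΩ : ∀ x, Ω x x = 0) {a c : ℕ} (ha : a < 6)
    (hc : c < 6) (hac : a ≠ c) (T : ℕ) (x : ℕ → V) (h : Ω (x a) (x c) ≠ 1) :
    InTable Ω (pullGates 15 (moveGates 6 a c) T) x ↔ InTable Ω T x := by
  rw [InTable, testBit_pullGates _ _ (moveGates_six_lt a ha c hc hac),
    applyGates_moveGates_of_not_adj hΩ (by omega) (by omega) hac x (decide_eq_false h), InTable]

/-- Every family whose graph belongs to `T` is equivalent to `E₆`. -/
def TableSound (Ω : BForm V) (T : ℕ) : Prop :=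
  ∀ x, IndepFamily 6 x → InTable Ω T x → EquivToE6 Ω (familySet 6 x)

theorem TableSound.or_pullGates {Ω : BForm V} (hΩ : ∀ x, Ω x x = 0) {T a c : ℕ}
    (hT : TableSound Ω T) (ha : a < 6) (hc : c < 6) (hac : a ≠ c) :
    TableSound Ω (T ||| pullGates 15 (moveGates 6 a c) T) := by
  intro x hx h
  rw [InTable, Nat.testBit_or, Bool.or_eq_true] at h
  rcases h with h | h
  · exact hT x hx h
  by_cases hΩac : Ω (x a) (x c) = 1
  · obtain ⟨Y, hY, hiso⟩ := hT _ (hx.update_add ha hc hac)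
      ((inTable_pullGates hΩ ha hc hac T x hΩac).1 h)
    refine ⟨Y, .head ⟨x a, x c, ⟨⟨a, ha⟩, rfl⟩, ⟨⟨c, hc⟩, rfl⟩, fun h => ?_, hΩac, ?_⟩ hY, hiso⟩
    · rw [h, hΩ] at hΩac
      exact zero_ne_one hΩac
    · exact hx.familySet_update hc _
  · exact hT x hx ((inTable_pullGates_of_ne hΩ ha hc hac T x hΩac).1 h)

theorem TableSound.sweepMoves {Ω : BForm V} (hΩ : ∀ x, Ω x x = 0) {T : ℕ}
    (hT : TableSound Ω T) : TableSound Ω (sweepMoves T) := by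
  refine List.foldlRecOn (motive := TableSound Ω) vertexPairs _ hT fun T hT m hm => ?_
  obtain ⟨ha, hc, hac⟩ := mem_vertexPairs.1 hm
  exact hT.or_pullGates hΩ ha hc hac

theorem e6Graph_adj_iff_testBit : ∀ i j : Fin 6, i < j →
    (E6Graph.Adj i j ↔ e6Index.testBit (edgeVar i j) = true) := by
  simp only [E6Graph, SimpleGraph.fromRel_adj]
  decide +kernel

theorem Gr_adj {Ω : BForm V} (hΩ : ∀ x, Ω x x = 0) {X : Set V} (u v : X) :
    (Gr Ω X).Adj u v ↔ Ω u.1 v.1 = 1 := by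
  rw [Gr, SimpleGraph.fromRel_adj, form_comm hΩ v.1, or_self, and_iff_right_iff_imp]
  rintro h rfl
  rw [hΩ] at h
  exact zero_ne_one h

theorem assignIndex_eq_e6Index_iff {Ω : BForm V} (hΩ : ∀ x, Ω x x = 0) (x : ℕ → V) :
    assignIndex 15 (graphAssign Ω x) = e6Index ↔
      ∀ i j : Fin 6, E6Graph.Adj i j ↔ Ω (x i) (x j) = 1 := by
  constructor
  · intro h
    have hlt : ∀ i j : Fin 6, i < j → (E6Graph.Adj i j ↔ Ω (x i) (x j) = 1) := by
      intro i j hij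
      have hE : edgeVar i j < 15 := by revert i j; decide +kernel
      rw [e6Graph_adj_iff_testBit i j hij, ← h, testBit_assignIndex _ hE,
        graphAssign_edgeVar hΩ x (by omega) (by omega) (by omega), adj, decide_eq_true_iff]
    intro i j
    rcases lt_trichotomy i j with hij | rfl | hij
    · exact hlt i j hij
    · simp [hΩ]
    · rw [SimpleGraph.adj_comm, form_comm hΩ, hlt j i hij]
  · intro h
    refine Nat.eq_of_testBit_eq fun t => ?_
    by_cases ht : t < 15
    · rw [testBit_assignIndex _ ht]
      obtain ⟨h₁, -, h₃, h₄⟩ := edgeVar_ends t (by omega)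
      have h₅ := e6Graph_adj_iff_testBit ⟨edgeBot t, h₁.trans (h₄ ht)⟩ ⟨edgeTop t, h₄ ht⟩ h₁
      rw [h] at h₅
      simp only [h₃] at h₅
      rw [graphAssign, adj, Bool.eq_iff_iff, ← h₅, decide_eq_true_iff]
    · have hlt : ∀ m < 2 ^ 15, m.testBit t = false := fun m hm =>
        Nat.testBit_lt_two_pow (hm.trans_le (Nat.pow_le_pow_right two_pos (by omega)))
      rw [hlt _ (assignIndex_lt _ _), hlt _ (by decide +kernel)]

theorem tableSound_e6Table {Ω : BForm V} (hΩ : ∀ x, Ω x x = 0) : TableSound Ω e6Table := by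
  suffices TableSound Ω (2 ^ e6Index) from ((this.sweepMoves hΩ).sweepMoves hΩ).sweepMoves hΩ
  intro x hx h
  rw [InTable, Nat.testBit_two_pow, decide_eq_true_iff, eq_comm,
    assignIndex_eq_e6Index_iff hΩ] at h
  refine ⟨familySet 6 x, .refl, ⟨RelIso.symm ⟨Equiv.ofInjective _ hx.injective, ?_⟩⟩⟩
  intro i j
  rw [Gr_adj hΩ, h]
  rfl

theorem exists_inTable_of_equivToE6 {Ω : BForm V} (hΩ : ∀ x, Ω x x = 0) {X : Set V}
    (hX : LinearIndependent (ZMod 2) (Subtype.val : X → V)) (h : EquivToE6 Ω X) :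
    ∃ x, IndepFamily 6 x ∧ familySet 6 x = X ∧ InTable Ω e6Table x := by
  obtain ⟨Y, hXY, ⟨f⟩⟩ := h
  induction hXY using Relation.ReflTransGen.head_induction_on with
  | refl =>
    let x : ℕ → V := fun i => if h : i < 6 then (f.symm ⟨i, h⟩).1 else 0
    have hval : (fun i : Fin 6 => x i) = Subtype.val ∘ f.symm := by
      funext i
      simp [x]
    refine ⟨x, ?_, ?_, ?_⟩
    · rw [IndepFamily, hval]
      exact hX.comp _ f.symm.injective
    · rw [familySet, hval, f.symm.surjective.range_comp, Subtype.range_val]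
    · rw [InTable, (assignIndex_eq_e6Index_iff hΩ x).2, testBit_e6Index_e6Table]
      intro i j
      rw [← f.symm.map_adj_iff, Gr_adj hΩ, congrFun hval i, congrFun hval j]
      rfl
  | head hmove _ ih =>
    have hback := hmove.symm hΩ hX
    obtain ⟨a, c, ha, hc, hac, -, rfl⟩ := hmove
    obtain ⟨x, hx, hxY, hT⟩ := ih (linearIndependent_move hX ha hc hac)
    obtain ⟨a', c', ha', hc', hac', hΩ', hX'⟩ := hback
    rw [← hxY] at ha' hc' hX'
    rw [hX']
    obtain ⟨⟨i, hi⟩, rfl⟩ := ha'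
    obtain ⟨⟨j, hj⟩, rfl⟩ := hc'
    have hij : i ≠ j := fun h => hac' (by simp [h])
    refine ⟨Function.update x j (x j + x i), hx.update_add hi hj hij, hx.familySet_update hj _, ?_⟩
    rwa [← inTable_pullGates hΩ hi hj hij _ x hΩ', pullGates_e6Table (i, j)
      (mem_vertexPairs.2 ⟨hi, hj, hij⟩)]

/-! ### Seven vectors -/

theorem testBit_e6WideTable (s : ℕ → Bool) :
    e6WideTable.testBit (assignIndex 21 s) = e6Table.testBit (assignIndex 15 s) :=
  testBit_widenTable 6 e6Table_lt s

theorem IndepFamily.replace {n : ℕ} {x : ℕ → V} (hx : IndepFamily (n + 1) x) (z : ℕ) :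
    IndepFamily n (Function.update x z (x n)) ∧
      familySet n (Function.update x z (x n)) ⊆ familySet (n + 1) x := by
  let f : Fin n → Fin (n + 1) := fun i => if i.1 = z then Fin.last n else i.castSucc
  have hf : Function.Injective f := by
    intro i j hij
    by_cases hi : i.1 = z <;> by_cases hj : j.1 = z <;>
      simp only [f, hi, hj, if_true, if_false, Fin.ext_iff, Fin.val_last, Fin.val_castSucc] at hij <;>
      omega
  have hval : (fun i : Fin n => Function.update x z (x n) i) =
      (fun i : Fin (n + 1) => x i) ∘ f := by
    funext i
    by_cases hi : i.1 = z <;> simp [f, hi]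
  constructor
  · rw [IndepFamily, hval]
    exact hx.comp f hf
  · rw [familySet, hval]
    exact Set.range_comp_subset_range _ _

theorem exists_equivToE6_of_testBit_e6SubTable {Ω : BForm V} (hΩ : ∀ x, Ω x x = 0) {y : ℕ → V}
    (hy : IndepFamily 7 y)
    (h : e6SubTable.testBit (assignIndex 21 (graphAssign Ω y)) = true) :
    HasE6Subgraph Ω (familySet 7 y) := by
  revert h
  refine List.foldlRecOn (motive := fun G : ℕ =>
    G.testBit (assignIndex 21 (graphAssign Ω y)) = true → HasE6Subgraph Ω (familySet 7 y))
    (List.range 6) _ ?_ ?_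
  · intro h
    rw [testBit_e6WideTable] at h
    have hy6 := hy.replace 6
    rw [Function.update_eq_self] at hy6
    exact ⟨_, hy6.2, tableSound_e6Table hΩ y hy6.1 h⟩
  · intro G hG z hz h
    rw [List.mem_range] at hz
    rw [Nat.testBit_or, Bool.or_eq_true] at h
    rcases h with h | h
    · exact hG h
    rw [testBit_pullGates _ _ (copyGates_seven_lt z hz), testBit_e6WideTable,
      assignIndex_congr fun t ht => applyGates_copyGates hΩ hz y ht] at h
    have hyz := hy.replace z
    exact ⟨_, hyz.2, tableSound_e6Table hΩ _ hyz.1 h⟩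

/-- If the first six of seven linearly independent vectors are equivalent to `E₆`, then adding
the seventh to one of them adjacent to it leaves six of the seven equivalent to `E₆`. -/
theorem hasE6Subgraph_update_seven {Ω : BForm V} (hΩ : ∀ x, Ω x x = 0) {y : ℕ → V}
    (hy : IndepFamily 7 y) (hT : InTable Ω e6Table y) {c : ℕ} (hc : c < 6)
    (h : Ω (y 6) (y c) = 1) :
    HasE6Subgraph Ω (familySet 7 (Function.update y c (y c + y 6))) := by
  refine exists_equivToE6_of_testBit_e6SubTable hΩ
    (hy.update_add (by omega) (by omega) (by omega)) ?_
  have hlt : edgeVar 6 c < 21 := (by decide +kernel : ∀ c < 6, edgeVar 6 c < 21) c hc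
  have hkey := congrArg (fun m => m.testBit (assignIndex 21 (graphAssign Ω y)))
    (e6WideTable_and_pullGates c hc)
  simp only [Nat.testBit_and] at hkey
  rw [testBit_e6WideTable, testBit_varTable _ hlt,
    graphAssign_edgeVar hΩ y (by omega) (by omega) (by omega), adj, decide_eq_true h, hT,
    testBit_pullGates _ _ (moveGates_seven_lt c hc), assignIndex_congr fun t ht =>
      applyGates_moveGates hΩ (.inr ⟨rfl, rfl⟩) (by omega) (by omega) (by omega) y
        (decide_eq_true h) ht] at hkey
  simpa using hkey

/-- If `Gr(B)` is connected and some `X ⊆ B` is equivalent to a set whose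
graph is `E₆`, then for any `a, c ∈ B` with `Ω(a,c) = 1`, the set `φ_{c,a}(B)` contains a
subset `X'` equivalent to a set whose graph is `E₆`. -/
theorem stmt_18 {V : Type*} [AddCommGroup V] [Module (ZMod 2) V]
    [FiniteDimensional (ZMod 2) V]
    (Ω : BForm V) (hΩ : ∀ x : V, Ω x x = 0)
    (B : Set V) (hli : LinearIndependent (ZMod 2) (Subtype.val : B → V))
    (hconn : (Gr Ω B).Connected)
    (hE6 : HasE6Subgraph Ω B)
    (a c : V) (ha : a ∈ B) (hc : c ∈ B) (hac : Ω a c = 1) :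
    HasE6Subgraph Ω (insert (c + a) (B \ {c})) := by
  have hne : a ≠ c := by
    rintro rfl
    rw [hΩ] at hac
    exact zero_ne_one hac
  obtain ⟨X, hXB, hX⟩ := hE6
  have hXli : LinearIndependent (ZMod 2) (Subtype.val : X → V) :=
    hli.comp (Set.inclusion hXB) (Set.inclusion_injective hXB)
  by_cases hcX : c ∈ X
  swap
  · exact ⟨X, fun v hv => .inr ⟨hXB hv, fun h => hcX (h ▸ hv)⟩, hX⟩
  by_cases haX : a ∈ X
  · obtain ⟨Y, hXY, hY⟩ := hX
    have hmove : MoveRel Ω X (insert (c + a) (X \ {c})) := ⟨a, c, haX, hcX, hne, hac, rfl⟩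
    exact ⟨_, Set.insert_subset_insert (Set.sdiff_subset_sdiff_left hXB), Y,
      .head (hmove.symm hΩ hXli) hXY, hY⟩
  obtain ⟨x, hx, rfl, hT⟩ := exists_inTable_of_equivToE6 hΩ hXli hX
  obtain ⟨⟨i, hi⟩, rfl⟩ := hcX
  let y : ℕ → V := Function.update x 6 a
  have hyx : ∀ j < 6, y j = x j := fun j hj => Function.update_of_ne hj.ne _ _
  have hy6 : y 6 = a := Function.update_self _ _ _
  have hyB : ∀ j : Fin 7, y j ∈ B := fun j => by
    rcases Nat.lt_succ_iff_lt_or_eq.1 j.2 with hj | hj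
    · rw [hyx j hj]
      exact hXB ⟨⟨j, hj⟩, rfl⟩
    · rw [hj, hy6]
      exact ha
  have hyinj : Function.Injective fun j : Fin 7 => (⟨y j, hyB j⟩ : B) := by
    intro j k hjk
    have hjk : y j = y k := congrArg Subtype.val hjk
    rcases Nat.lt_succ_iff_lt_or_eq.1 j.2 with hj | hj <;>
      rcases Nat.lt_succ_iff_lt_or_eq.1 k.2 with hk | hk
    · rw [hyx j hj, hyx k hk] at hjk
      have := LinearIndependent.injective hx (a₁ := ⟨j, hj⟩) (a₂ := ⟨k, hk⟩) hjk
      simpa [Fin.ext_iff] using this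
    · rw [hyx j hj, hk, hy6] at hjk
      exact absurd ⟨⟨j, hj⟩, hjk⟩ haX
    · rw [hyx k hk, hj, hy6] at hjk
      exact absurd ⟨⟨k, hk⟩, hjk.symm⟩ haX
    · exact Fin.ext (hj.trans hk.symm)
  have hyli : IndepFamily 7 y := hli.comp _ hyinj
  have hyT : InTable Ω e6Table y := by
    rw [InTable, assignIndex_congr (s' := graphAssign Ω x) fun t ht => ?_]
    · exact hT
    · obtain ⟨h₁, -, -, h₂⟩ := edgeVar_ends t (by omega)
      rw [graphAssign, hyx _ (h₂ ht), hyx _ (h₁.trans (h₂ ht)), graphAssign]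
  obtain ⟨X', hX', hE⟩ := hasE6Subgraph_update_seven hΩ hyli hyT hi
    (by rw [hy6, hyx i hi]; exact hac)
  refine ⟨X', hX'.trans ?_, hE⟩
  rw [hyli.familySet_update (by omega), hy6, hyx i hi]
  refine Set.insert_subset_insert (Set.sdiff_subset_sdiff_left ?_)
  rintro _ ⟨j, rfl⟩
  exact hyB j
end
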